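/- arXiv:2605.13454 — 5 statements merged into one kernel-verified Lean document; each statement's English description precedes it below -/
import Mathlib

section
/- Let K : ℕ → ℕ be a function with K(p) ≥ 1 for every prime p, and for every prime p let A(p) ⊆ 𝔽_p be a set. Suppose that, as p → ∞ along primes, |A(p)|/p → 1/2 and max{ |A(p) △ (a·A(p) + b)| / p : a, b ∈ ℤ, 1 ≤ |a| ≤ K(p), |b| ≤ K(p), p ∤ a } → 0 (here a·A(p)+b is computed after reducing a and b modulo p). Then K(p)/log p → 0 as p → ∞ along primes. -/
open Filter
open scoped symmDiff
open ZMod in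
lemma parseval90 (p : ℕ) [NeZero p] (f : ZMod p → ℂ) :
    ∑ k, ‖ZMod.dft f k‖ ^ 2 = p * ∑ x, ‖f x‖ ^ 2 := by
  have h : (∑ k, (starRingEnd ℂ) (ZMod.dft f k) * ZMod.dft f k) = p * ∑ x, (starRingEnd ℂ) (f x) * f x := by
    have h1 : ∀ k, (starRingEnd ℂ) (ZMod.dft f k) * ZMod.dft f k
        = ∑ j, (starRingEnd ℂ) (f j) * (stdAddChar (-(k * -j)) • ZMod.dft f k) := by
      intro k
      nth_rewrite 1 [ZMod.dft_apply]
      rw [map_sum, Finset.sum_mul]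
      refine Finset.sum_congr rfl fun j _ => ?_
      rw [smul_eq_mul, smul_eq_mul, map_mul, ← AddChar.map_neg_eq_conj, mul_comm k, neg_mul]
      ring
    simp_rw [h1]
    rw [Finset.sum_comm, Finset.mul_sum]
    refine Finset.sum_congr rfl fun j _ => ?_
    rw [← Finset.mul_sum, ← ZMod.dft_apply, ZMod.dft_dft]
    simp only [neg_neg, smul_eq_mul]
    ring
  simp_rw [Complex.conj_mul'] at h
  exact_mod_cast h

noncomputable def F90 {p : ℕ} [NeZero p] (A : Finset (ZMod p)) (k : ZMod p) : ℂ :=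
  ∑ x ∈ A, ZMod.stdAddChar (-(x * k))

lemma F90_apply {p : ℕ} [NeZero p] (A : Finset (ZMod p)) (k : ZMod p) :
    F90 A k = ∑ x ∈ A, ZMod.stdAddChar (-(x * k)) := rfl

lemma F90_dft {p : ℕ} [NeZero p] (A : Finset (ZMod p)) (k : ZMod p) :
    F90 A k = ZMod.dft (fun x => if x ∈ A then (1:ℂ) else 0) k := by
  simp [F90_apply, ZMod.dft_apply, Finset.sum_ite_mem]

lemma F90_diff {p : ℕ} [NeZero p] (A B : Finset (ZMod p)) :
    ∑ k, ‖F90 A k - F90 B k‖ ^ 2 = p * ((A ∆ B).card : ℝ) := by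
  have h : ∀ k, F90 A k - F90 B k = ZMod.dft ((fun x => if x ∈ A then (1:ℂ) else 0) -
      (fun x => if x ∈ B then (1:ℂ) else 0)) k := by
    intro k
    rw [map_sub, Pi.sub_apply, F90_dft, F90_dft]
  simp_rw [h]
  rw [parseval90, Finset.card_eq_sum_ones, Nat.cast_sum]
  congr 1
  rw [← Finset.sum_filter_add_sum_filter_not Finset.univ (fun x => x ∈ A ∆ B)]
  have h1 : (∑ x with ¬ x ∈ A ∆ B, ‖((fun x => if x ∈ A then (1:ℂ) else 0) -
      (fun x => if x ∈ B then (1:ℂ) else 0)) x‖ ^ 2) = 0 := by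
    refine Finset.sum_eq_zero fun x hx => ?_
    simp only [Finset.mem_filter, Finset.mem_univ, true_and, Finset.mem_symmDiff] at hx
    by_cases h1 : x ∈ A <;> by_cases h2 : x ∈ B <;> simp_all
  rw [h1, add_zero]
  refine Finset.sum_congr (by ext; simp) fun x hx => ?_
  rw [Finset.mem_symmDiff] at hx
  by_cases h1 : x ∈ A <;> by_cases h2 : x ∈ B <;> simp_all

lemma F90_total {p : ℕ} [NeZero p] (A : Finset (ZMod p)) :
    ∑ k, ‖F90 A k‖ ^ 2 = p * (A.card : ℝ) := by
  have := F90_diff A ∅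
  have h0 : A ∆ ∅ = A := symmDiff_bot A
  rw [h0] at this
  simpa [F90_apply] using this

lemma F90_zero {p : ℕ} [NeZero p] (A : Finset (ZMod p)) : F90 A 0 = A.card := by
  simp [F90_apply]

lemma F90_W {p : ℕ} [NeZero p] (A : Finset (ZMod p)) :
    ∑ k ∈ Finset.univ.erase 0, ‖F90 A k‖ ^ 2 = p * (A.card : ℝ) - (A.card : ℝ)^2 := by
  rw [← F90_total A, ← Finset.add_sum_erase _ _ (Finset.mem_univ (0 : ZMod p)), F90_zero]
  simp

lemma F90_image {p : ℕ} [Fact p.Prime] (A : Finset (ZMod p)) (a b k : ZMod p) (ha : a ≠ 0) :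
    F90 (A.image fun x => a * x + b) k = ZMod.stdAddChar (-(b * k)) * F90 A (a * k) := by
  rw [F90_apply, F90_apply, Finset.sum_image, Finset.mul_sum]
  · refine Finset.sum_congr rfl fun x _ => ?_
    rw [← AddChar.map_add_eq_mul]
    congr 1; ring
  · intro x _ y _ h
    simpa [ha] using h

lemma trig90 (t : ℝ) (n : ℕ) :
    Real.sin t * (1 + 2 * ∑ b ∈ Finset.Icc 1 n, Real.cos (2 * b * t)) = Real.sin ((2 * n + 1) * t) := by
  induction n with
  | zero => simp
  | succ n ih =>
    rw [Finset.sum_Icc_succ_top (by omega), mul_add 2, ← add_assoc, mul_add, ih]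
    have h1 : (2 * (n:ℝ) + 1) * t = 2 * ((n + 1 : ℕ) : ℝ) * t - t := by push_cast; ring
    have h2 : (2 * ((n + 1 : ℕ) : ℝ) + 1) * t = 2 * ((n + 1 : ℕ) : ℝ) * t + t := by push_cast; ring
    rw [h1, h2, Real.sin_sub, Real.sin_add]
    ring

lemma normchar90 {p : ℕ} [NeZero p] (b : ℕ) (k : ZMod p) :
    ‖1 - (ZMod.stdAddChar (-((b : ZMod p) * k)) : ℂ)‖ ^ 2
      = 2 - 2 * Real.cos (2 * b * (Real.pi * (|k.valMinAbs| : ℤ) / p)) := by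
  have h : -((b : ZMod p) * k) = ((-(b * k.valMinAbs) : ℤ) : ZMod p) := by
    push_cast; simp
  have h2 : Real.cos (2 * b * (Real.pi * (|k.valMinAbs| : ℤ) / p)) =
      Real.cos (2 * b * (Real.pi * (k.valMinAbs : ℤ) / p)) := by
    push_cast
    rcases abs_choice (k.valMinAbs : ℝ) with h | h
    · rw [h]
    · rw [h, ← Real.cos_neg]; congr 1; ring
  rw [h2, h, ZMod.stdAddChar_coe]
  have h3 : (2 * Real.pi * Complex.I * ((-(b * k.valMinAbs) : ℤ) : ℂ) / p : ℂ) =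
      ((-(2 * b * (Real.pi * (k.valMinAbs : ℤ) / p)) : ℝ) : ℂ) * Complex.I := by
    push_cast; ring
  rw [h3, Complex.exp_mul_I, ← Complex.ofReal_cos, ← Complex.ofReal_sin, ← Complex.normSq_eq_norm_sq,
    Complex.normSq_apply]
  simp only [Complex.sub_re, Complex.sub_im, Complex.add_re, Complex.add_im, Complex.mul_re,
    Complex.mul_im, Complex.I_re, Complex.I_im, Complex.ofReal_re, Complex.ofReal_im,
    Complex.one_re, Complex.one_im, Real.cos_neg, Real.sin_neg]
  nlinarith [Real.sin_sq_add_cos_sq (2 * b * (Real.pi * (k.valMinAbs : ℝ) / p))]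

lemma sumchar90 {p : ℕ} [NeZero p] (n : ℕ) (k : ZMod p)
    (hk : (p : ℤ) ≤ 2 * n * |k.valMinAbs|) :
    (n : ℝ) ≤ ∑ b ∈ Finset.Icc 1 n, ‖1 - (ZMod.stdAddChar (-((b : ZMod p) * k)) : ℂ)‖ ^ 2 := by
  simp_rw [normchar90]
  rw [Finset.sum_sub_distrib, ← Finset.mul_sum]
  set t : ℝ := Real.pi * (|k.valMinAbs| : ℤ) / p with ht
  have hp : (0 : ℝ) < p := by exact_mod_cast Nat.pos_of_ne_zero (NeZero.ne p)
  have h1 := trig90 t n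
  have hv : 2 * |k.valMinAbs| ≤ p := by
    have := ZMod.natAbs_valMinAbs_le k
    rw [Int.abs_eq_natAbs]
    omega
  have hv' : (2 : ℝ) * (|k.valMinAbs| : ℤ) ≤ p := by exact_mod_cast hv
  have hk' : (p : ℝ) ≤ 2 * n * (|k.valMinAbs| : ℤ) := by exact_mod_cast hk
  have ht0 : 0 ≤ t := by positivity
  have ht2 : t ≤ Real.pi / 2 := by
    rw [ht, div_le_iff₀ hp]
    nlinarith [Real.pi_pos]
  have hs := Real.mul_le_sin ht0 ht2
  have hs2 : 2 / Real.pi * t = 2 * (|k.valMinAbs| : ℤ) / p := by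
    rw [ht]; field_simp
  rw [hs2] at hs
  have hs3 : 1 ≤ n * Real.sin t := by
    have : 1 ≤ n * (2 * ((|k.valMinAbs| : ℤ) : ℝ) / p) := by
      rw [← mul_div_assoc, le_div_iff₀ hp]; linarith
    exact this.trans (by gcongr)
  have hspos : 0 < Real.sin t := by
    by_contra hc
    have : (n : ℝ) * Real.sin t ≤ 0 := mul_nonpos_of_nonneg_of_nonpos (by positivity) (by linarith)
    linarith
  have hle := Real.sin_le_one ((2 * n + 1) * t)
  rw [← h1] at hle
  have : (1 + 2 * ∑ b ∈ Finset.Icc 1 n, Real.cos (2 * b * t)) ≤ n := by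
    by_contra hc
    push Not at hc
    nlinarith
  simp
  linarith

/-- The mass of high frequencies is small. -/
lemma high90 {p : ℕ} [Fact p.Prime] (A : Finset (ZMod p)) (N : ℕ) (hN : 1 ≤ N) (ε : ℝ)
    (htr : ∀ b : ℕ, 1 ≤ b → b ≤ N →
      ((A ∆ (A.image fun x => (1 : ZMod p) * x + (b : ZMod p))).card : ℝ) ≤ ε * p) :
    ∑ k, (if (p : ℤ) ≤ 2 * N * |k.valMinAbs| then ‖F90 A k‖ ^ 2 else 0) ≤ ε * p ^ 2 := by
  have hNpos : (0 : ℝ) < N := by exact_mod_cast hN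
  have h1 : ∀ b ∈ Finset.Icc 1 N, ∑ k, ‖F90 A k‖ ^ 2 *
      ‖1 - (ZMod.stdAddChar (-((b : ZMod p) * k)) : ℂ)‖ ^ 2 ≤ ε * p ^ 2 := by
    intro b hb
    rw [Finset.mem_Icc] at hb
    have h := F90_diff A (A.image fun x => (1 : ZMod p) * x + (b : ZMod p))
    have h2 : ∀ k, ‖F90 A k - F90 (A.image fun x => (1 : ZMod p) * x + (b : ZMod p)) k‖ ^ 2 =
      ‖F90 A k‖ ^ 2 * ‖1 - (ZMod.stdAddChar (-((b : ZMod p) * k)) : ℂ)‖ ^ 2 := by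
      intro k
      rw [F90_image _ _ _ _ one_ne_zero, one_mul, ← mul_pow, ← norm_mul]
      congr 2; ring
    simp_rw [h2] at h
    rw [h]
    have := htr b hb.1 hb.2
    have hp : (0:ℝ) ≤ p := by positivity
    nlinarith
  have h2 := Finset.sum_le_sum h1
  rw [Finset.sum_comm] at h2
  simp only [Finset.sum_const, Nat.card_Icc, Nat.add_sub_cancel, nsmul_eq_mul] at h2
  have h3 : (N : ℝ) * ∑ k, (if (p : ℤ) ≤ 2 * N * |k.valMinAbs| then ‖F90 A k‖ ^ 2 else 0) ≤
      N * (ε * p ^ 2) := by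
    refine le_trans ?_ h2
    rw [Finset.mul_sum]
    refine Finset.sum_le_sum fun k _ => ?_
    rw [← Finset.mul_sum]
    split_ifs with hk
    · rw [mul_comm]
      exact mul_le_mul_of_nonneg_left (sumchar90 N k hk) (by positivity)
    · rw [mul_zero]; positivity
  exact le_of_mul_le_mul_left h3 hNpos

lemma step90 {p : ℕ} [Fact p.Prime] (N q j : ℕ) (hq : 1 ≤ q) (hqN : q ≤ N) (k : ZMod p)
    (h : ¬ ((q : ℤ) ^ (j + 1) ∣ ((q : ZMod p) * k).valMinAbs)) :
    (¬ ((q : ℤ) ^ j ∣ k.valMinAbs)) ∨ (p : ℤ) ≤ 2 * N * |k.valMinAbs| := by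
  by_contra hc
  push Not at hc
  obtain ⟨h1, h2⟩ := hc
  apply h
  have h3 : ((q : ZMod p) * k).valMinAbs = q * k.valMinAbs := by
    rw [ZMod.valMinAbs_spec]
    constructor
    · push_cast; simp
    · have hq' : (q : ℤ) ≤ N := by exact_mod_cast hqN
      have h4 : |(q : ℤ) * k.valMinAbs * 2| < p := by
        rw [abs_mul, abs_mul]
        simp only [Nat.abs_cast, Nat.abs_ofNat]
        nlinarith [abs_nonneg k.valMinAbs]
      rw [abs_lt] at h4
      exact ⟨h4.1, h4.2.le⟩
  rw [h3, pow_succ']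
  exact mul_dvd_mul_left _ h1

lemma low90 {p : ℕ} [Fact p.Prime] (A : Finset (ZMod p)) (N : ℕ) (hN : 1 ≤ N) (hNp : N < p)
    (ε : ℝ) (hε : 0 ≤ ε)
    (htr : ∀ b : ℕ, 1 ≤ b → b ≤ N →
      ((A ∆ (A.image fun x => (1 : ZMod p) * x + (b : ZMod p))).card : ℝ) ≤ ε * p)
    (q : ℕ) (hq : 1 ≤ q) (hqN : q ≤ N)
    (hdil : ((A ∆ (A.image fun x => (q : ZMod p) * x + 0)).card : ℝ) ≤ ε * p) (j : ℕ) :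
    ∑ k, (if (q : ℤ) ^ j ∣ (k : ZMod p).valMinAbs then 0 else ‖F90 A k‖ ^ 2)
      ≤ 4 * (2 ^ j - 1) * (ε * p ^ 2) := by
  have hq0 : (q : ZMod p) ≠ 0 := by
    intro h
    rw [ZMod.natCast_eq_zero_iff] at h
    have := Nat.le_of_dvd hq h
    omega
  induction j with
  | zero => simp
  | succ j ih =>
    have hB := high90 A N hN ε htr
    have hD := F90_diff A (A.image fun x => (q : ZMod p) * x + 0)
    simp_rw [F90_image _ _ _ _ hq0, zero_mul, neg_zero, AddChar.map_zero_eq_one, one_mul] at hD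
    have hD' : ∑ k, ‖F90 A k - F90 A (q * k)‖ ^ 2 ≤ ε * p ^ 2 := by
      rw [hD]
      have hp : (0:ℝ) ≤ p := by positivity
      nlinarith
    rw [← Equiv.sum_comp (Equiv.mulLeft₀ (q : ZMod p) hq0)]
    simp only [Equiv.mulLeft₀_apply]
    have key : ∀ k : ZMod p, (if (q : ℤ) ^ (j + 1) ∣ ((q : ZMod p) * k).valMinAbs then 0
          else ‖F90 A (q * k)‖ ^ 2) ≤
        2 * (if (q : ℤ) ^ j ∣ (k : ZMod p).valMinAbs then 0 else ‖F90 A k‖ ^ 2) +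
        2 * (if (p : ℤ) ≤ 2 * N * |k.valMinAbs| then ‖F90 A k‖ ^ 2 else 0) +
        2 * ‖F90 A k - F90 A (q * k)‖ ^ 2 := by
      intro k
      have h0 : 0 ≤ ‖F90 A k‖ ^ 2 := by positivity
      have h0' : 0 ≤ ‖F90 A k - F90 A (q * k)‖ ^ 2 := by positivity
      have htri : ‖F90 A (q * k)‖ ^ 2 ≤ 2 * ‖F90 A k‖ ^ 2 + 2 * ‖F90 A k - F90 A (q * k)‖ ^ 2 := by
        have h1 : ‖F90 A (q * k)‖ ≤ ‖F90 A k‖ + ‖F90 A k - F90 A (q * k)‖ := by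
          have := norm_sub_le (F90 A k) (F90 A k - F90 A (q * k))
          rwa [sub_sub_cancel] at this
        nlinarith [norm_nonneg (F90 A (q * k)), sq_nonneg (‖F90 A k‖ - ‖F90 A k - F90 A (q * k)‖)]
      by_cases h : (q : ℤ) ^ (j + 1) ∣ ((q : ZMod p) * k).valMinAbs
      · rw [if_pos h]
        split_ifs <;> linarith
      · rw [if_neg h]
        rcases step90 N q j hq hqN k h with h | h
        · rw [if_neg h]
          split_ifs <;> linarith
        · rw [if_pos h]
          split_ifs <;> linarith
    refine (Finset.sum_le_sum fun k _ => key k).trans ?_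
    rw [Finset.sum_add_distrib, Finset.sum_add_distrib, ← Finset.mul_sum, ← Finset.mul_sum,
      ← Finset.mul_sum, pow_succ]
    linarith

lemma logbound90 {p : ℕ} [Fact p.Prime] (N M : ℕ) (k : ZMod p) (hk : k ≠ 0) :
    ∑ q ∈ Nat.primesLE N, (if (q : ℤ) ^ M ∣ k.valMinAbs then M * Real.log q else 0)
      ≤ Real.log p := by
  rw [← Finset.sum_filter]
  set s := (Nat.primesLE N).filter (fun q : ℕ => (q : ℤ) ^ M ∣ k.valMinAbs)
  have hs : ∀ q ∈ s, q.Prime ∧ q ^ M ∣ k.valMinAbs.natAbs := by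
    intro q hq
    rw [Finset.mem_filter, Nat.mem_primesLE] at hq
    refine ⟨hq.1.2, ?_⟩
    rw [← Int.natCast_dvd]
    exact_mod_cast hq.2
  have hd : ∏ q ∈ s, q ^ M ∣ k.valMinAbs.natAbs := by
    refine Finset.prod_dvd_of_isRelPrime ?_ fun q hq => (hs q hq).2
    intro a ha b hb hab
    rw [Function.onFun, ← Nat.coprime_iff_isRelPrime]
    exact Nat.Coprime.pow _ _ ((Nat.coprime_primes (hs a ha).1 (hs b hb).1).2 hab)
  have hv : 0 < k.valMinAbs.natAbs := by
    rw [Int.natAbs_pos, ne_eq, ZMod.valMinAbs_eq_zero]; exact hk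
  have hle := Nat.le_of_dvd hv hd
  have hle2 := ZMod.natAbs_valMinAbs_le k
  have hle3 : ∏ q ∈ s, q ^ M ≤ p := by omega
  have hpos : 0 < ∏ q ∈ s, q ^ M := Finset.prod_pos fun q hq => pow_pos (hs q hq).1.pos _
  have : ∑ q ∈ s, (M : ℝ) * Real.log q = Real.log ((∏ q ∈ s, q ^ M : ℕ) : ℝ) := by
    push_cast
    rw [Real.log_prod]
    · simp
    · intro q hq
      have := (hs q hq).1.pos
      positivity
  rw [this]
  exact Real.log_le_log (by exact_mod_cast hpos) (by exact_mod_cast hle3)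

lemma core90 {p : ℕ} [Fact p.Prime] (A : Finset (ZMod p)) (N : ℕ) (hN : 1 ≤ N) (hNp : N < p)
    (ε : ℝ) (hε : 0 ≤ ε) (M : ℕ)
    (htr : ∀ b : ℕ, 1 ≤ b → b ≤ N →
      ((A ∆ (A.image fun x => (1 : ZMod p) * x + (b : ZMod p))).card : ℝ) ≤ ε * p)
    (hdil : ∀ q : ℕ, 1 ≤ q → q ≤ N →
      ((A ∆ (A.image fun x => (q : ZMod p) * x + 0)).card : ℝ) ≤ ε * p) :
    M * Chebyshev.theta N * ((p * (A.card : ℝ) - (A.card : ℝ)^2) - 4 * 2 ^ M * (ε * p ^ 2))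
      ≤ (p * (A.card : ℝ) - (A.card : ℝ)^2) * Real.log p := by
  set W := (p * (A.card : ℝ) - (A.card : ℝ)^2) with hW
  have hWs := F90_W A
  rw [← hW] at hWs
  rw [Chebyshev.theta_eq_sum_primesLE_log, Finset.mul_sum, Finset.sum_mul]
  have h1 : ∀ q ∈ Nat.primesLE N, M * Real.log q * (W - 4 * 2 ^ M * (ε * p ^ 2)) ≤
      ∑ k ∈ Finset.univ.erase (0 : ZMod p),
        ‖F90 A k‖ ^ 2 * (if (q : ℤ) ^ M ∣ k.valMinAbs then M * Real.log q else 0) := by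
    intro q hq
    rw [Nat.mem_primesLE] at hq
    have h := low90 A N hN hNp ε hε htr q hq.2.one_le hq.1 (hdil q hq.2.one_le hq.1) M
    have h2 : ∑ k ∈ Finset.univ.erase (0 : ZMod p),
        (if (q : ℤ) ^ M ∣ (k : ZMod p).valMinAbs then 0 else ‖F90 A k‖ ^ 2) ≤
        4 * 2 ^ M * (ε * p ^ 2) := by
      refine le_trans (Finset.sum_le_sum_of_subset_of_nonneg (Finset.erase_subset _ _) ?_)
        (h.trans ?_)
      · intro k _ _
        split_ifs <;> positivity
      · have : 0 ≤ ε * p ^ 2 := by positivity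
        nlinarith
    have h3 : ∀ k : ZMod p, ‖F90 A k‖ ^ 2 * (if (q : ℤ) ^ M ∣ k.valMinAbs then M * Real.log q else 0)
      = M * Real.log q * (‖F90 A k‖ ^ 2 -
        (if (q : ℤ) ^ M ∣ (k : ZMod p).valMinAbs then 0 else ‖F90 A k‖ ^ 2)) := by
      intro k
      split_ifs <;> ring
    simp_rw [h3]
    rw [← Finset.mul_sum, Finset.sum_sub_distrib, hWs]
    have h4 : 0 ≤ Real.log q := Real.log_natCast_nonneg q
    gcongr
  refine (Finset.sum_le_sum h1).trans ?_
  rw [Finset.sum_comm, ← hWs, Finset.sum_mul]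
  refine Finset.sum_le_sum fun k hk => ?_
  rw [← Finset.mul_sum]
  exact mul_le_mul_of_nonneg_left (logbound90 N M k (Finset.ne_of_mem_erase hk)) (by positivity)

lemma theta90 : ∃ C : ℝ, ∀ n : ℕ, (n : ℝ) / 4 - C ≤ Chebyshev.theta n := by
  have h := (isLittleO_log_rpow_atTop (r := 1/2) (by norm_num)).bound (c := 1/12) (by norm_num)
  have h' := tendsto_natCast_atTop_atTop (R := ℝ) |>.eventually h
  rw [eventually_atTop] at h'
  obtain ⟨n0, hn0⟩ := h'
  refine ⟨max 1 n0, fun n => ?_⟩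
  have hc1 : (1 : ℝ) ≤ max 1 (n0 : ℝ) := le_max_left _ _
  have hc2 : (n0 : ℝ) ≤ max 1 (n0 : ℝ) := le_max_right _ _
  by_cases hn : n0 ≤ n ∧ 1 ≤ n
  · have h1 := hn0 n hn.1
    have hn1 : (1 : ℝ) ≤ n := by exact_mod_cast hn.2
    have hlog := Real.log_nonneg hn1
    rw [← Real.sqrt_eq_rpow, Real.norm_of_nonneg hlog, Real.norm_of_nonneg (Real.sqrt_nonneg _)] at h1
    have h2 := Chebyshev.theta_ge n
    have hs : √(n:ℝ) * √n = n := Real.mul_self_sqrt (by positivity)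
    have hs1 : 1 ≤ √(n:ℝ) := Real.one_le_sqrt.2 hn1
    have h3 : √(n:ℝ) * Real.log n ≤ n / 12 := by nlinarith
    have h4 : Real.log (n + 1) ≤ Real.log 2 + Real.log n := by
      rw [← Real.log_mul (by norm_num) (by positivity)]
      exact Real.log_le_log (by positivity) (by linarith)
    have h5 : Real.log n ≤ √(n:ℝ) * Real.log n := by nlinarith
    have := Real.log_two_gt_d9
    have := Real.log_two_lt_d9
    nlinarith
  · have h0 := Chebyshev.theta_nonneg n
    have : (n : ℝ) ≤ max 1 (n0 : ℝ) := by
      by_cases h1 : n0 ≤ n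
      · have : n ≤ 1 := by omega
        exact le_trans (by exact_mod_cast this) hc1
      · have : n ≤ n0 := by omega
        exact le_trans (by exact_mod_cast this) hc2
    have : (0:ℝ) ≤ n := by positivity
    linarith

/-- **Green's Problem 90, upper bound.**
If for every prime `p` there is a set `A p ⊆ 𝔽_p` of density `1/2` which is almost invariant
under all affine maps `x ↦ a x + b` with `1 ≤ |a| ≤ K p`, `|b| ≤ K p`, `p ∤ a`,
then `K p = o(log p)` as `p → ∞` along primes. -/
theorem stmt_0 (K : ℕ → ℕ) (hK : ∀ p : ℕ, p.Prime → 1 ≤ K p)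
    (A : (p : ℕ) → Finset (ZMod p))
    (hdens : Tendsto (fun p : ℕ => ((A p).card : ℝ) / p)
      (atTop ⊓ 𝓟 {p : ℕ | p.Prime}) (nhds (1 / 2)))
    (hinv : ∀ δ : ℝ, 0 < δ →
      ∀ᶠ p in (atTop ⊓ 𝓟 {p : ℕ | p.Prime}),
        ∀ a b : ℤ, 1 ≤ |a| → |a| ≤ (K p : ℤ) → |b| ≤ (K p : ℤ) → ¬ ((p : ℤ) ∣ a) →
          (((A p) ∆ ((A p).image fun x => (a : ZMod p) * x + (b : ZMod p))).card : ℝ) / p ≤ δ) :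
    Tendsto (fun p : ℕ => (K p : ℝ) / Real.log p)
      (atTop ⊓ 𝓟 {p : ℕ | p.Prime}) (nhds 0) := by
  obtain ⟨C, hC⟩ := theta90
  rw [Metric.tendsto_nhds]
  intro η hη
  obtain ⟨M, hM⟩ := exists_nat_ge (32 / η)
  have hMpos : (0 : ℝ) < M := lt_of_lt_of_le (by positivity) hM
  set ε : ℝ := 1 / (64 * 2 ^ M) with hεdef
  have hε : 0 < ε := by positivity
  have hlog : Tendsto (fun p : ℕ => Real.log p) atTop atTop :=
    Real.tendsto_log_atTop.comp tendsto_natCast_atTop_atTop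
  have e1 : ∀ᶠ p : ℕ in (atTop ⊓ 𝓟 {p : ℕ | p.Prime}), max 1 (16 * C / η) ≤ Real.log p :=
    (hlog.eventually (eventually_ge_atTop _)).filter_mono inf_le_left
  have e2 : ∀ᶠ p : ℕ in (atTop ⊓ 𝓟 {p : ℕ | p.Prime}), ‖Real.log p‖ ≤ 1 / η * ‖(p : ℝ)‖ :=
    ((tendsto_natCast_atTop_atTop (R := ℝ)).eventually
      (Real.isLittleO_log_id_atTop.bound (c := 1 / η) (by positivity))).filter_mono inf_le_left
  have e3 : ∀ᶠ p : ℕ in (atTop ⊓ 𝓟 {p : ℕ | p.Prime}), 3 ≤ p :=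
    (eventually_ge_atTop 3).filter_mono inf_le_left
  have e4 : ∀ᶠ p : ℕ in (atTop ⊓ 𝓟 {p : ℕ | p.Prime}), p.Prime :=
    (eventually_principal.2 fun _ h => h).filter_mono inf_le_right
  have e5 := (Metric.tendsto_nhds.1 hdens) (1 / 4) (by norm_num)
  filter_upwards [e1, e2, e3, e4, e5, hinv ε hε] with p h1 h2 h3 h4 h5 h6
  haveI : Fact p.Prime := ⟨h4⟩
  have hp : (0 : ℝ) < p := by exact_mod_cast h4.pos
  have hp3 : (3 : ℝ) ≤ p := by exact_mod_cast h3
  have hL : 1 ≤ Real.log p := (le_max_left _ _).trans h1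
  have hLC : 16 * C / η ≤ Real.log p := (le_max_right _ _).trans h1
  set N := min (K p) (p - 1) with hNdef
  have hKp := hK p h4
  have hN : 1 ≤ N := by omega
  have hNp : N < p := by omega
  have hNK : N ≤ K p := min_le_left _ _
  have htr : ∀ b : ℕ, 1 ≤ b → b ≤ N →
      (((A p) ∆ ((A p).image fun x => (1 : ZMod p) * x + (b : ZMod p))).card : ℝ) ≤ ε * p := by
    intro b _ hb
    have := h6 1 b (by simp) (by simpa using hKp)
      (by rw [Nat.abs_cast]; exact_mod_cast hb.trans hNK) (by
        intro h
        have := Int.le_of_dvd one_pos h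
        omega)
    rw [div_le_iff₀ hp] at this
    simpa only [Int.cast_one, Int.cast_natCast] using this
  have hdil : ∀ q : ℕ, 1 ≤ q → q ≤ N →
      (((A p) ∆ ((A p).image fun x => (q : ZMod p) * x + 0)).card : ℝ) ≤ ε * p := by
    intro q hq1 hq
    have := h6 q 0 (by rw [Nat.abs_cast]; exact_mod_cast hq1)
      (by rw [Nat.abs_cast]; exact_mod_cast hq.trans hNK) (by simp) (by
        intro h
        have := Int.le_of_dvd (by exact_mod_cast hq1) h
        omega)
    rw [div_le_iff₀ hp] at this
    simpa only [Int.cast_zero, Int.cast_natCast] using this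
  have hcore := core90 (A p) N hN hNp ε hε.le M htr hdil
  have hW : (p : ℝ) ^ 2 / 8 ≤ p * ((A p).card : ℝ) - ((A p).card : ℝ) ^ 2 := by
    rw [Real.dist_eq, abs_lt] at h5
    set α := ((A p).card : ℝ) / p with hα
    have hA : ((A p).card : ℝ) = α * p := by rw [hα]; field_simp
    rw [hA]
    have : 1 / 8 ≤ α - α ^ 2 := by nlinarith
    nlinarith [sq_nonneg (p : ℝ)]
  set W := p * ((A p).card : ℝ) - ((A p).card : ℝ) ^ 2
  have hWpos : 0 < W := lt_of_lt_of_le (by positivity) hW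
  have hθ := Chebyshev.theta_nonneg (N : ℝ)
  have h7 : 4 * 2 ^ M * (ε * p ^ 2) = (p : ℝ) ^ 2 / 16 := by
    rw [hεdef]; field_simp; norm_num
  rw [h7] at hcore
  have h8 : M * Chebyshev.theta N / 2 ≤ Real.log p := by
    have : (M * Chebyshev.theta N / 2) * W ≤ Real.log p * W := by
      have h9 : W / 2 ≤ W - (p : ℝ) ^ 2 / 16 := by linarith
      have h10 := mul_le_mul_of_nonneg_left h9 (mul_nonneg hMpos.le hθ)
      linarith
    exact le_of_mul_le_mul_right this hWpos
  have h9 : Chebyshev.theta N ≤ η / 16 * Real.log p := by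
    have h10 : 32 ≤ M * η := by rwa [div_le_iff₀ hη] at hM
    have h11 : 32 * Chebyshev.theta N ≤ M * η * Chebyshev.theta N :=
      mul_le_mul_of_nonneg_right h10 hθ
    nlinarith
  have h10 : (N : ℝ) ≤ η / 2 * Real.log p := by
    have := hC N
    rw [div_le_iff₀ hη] at hLC
    linarith
  have h11 : N ≠ p - 1 := by
    intro h
    have h12 : (N : ℝ) = p - 1 := by rw [h, Nat.cast_sub (by omega)]; simp
    rw [Real.norm_of_nonneg (by linarith), Real.norm_of_nonneg hp.le] at h2
    have h13 : η / 2 * Real.log p ≤ p / 2 := by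
      calc η / 2 * Real.log p ≤ η / 2 * (1 / η * p) := by gcongr
        _ = p / 2 := by field_simp
    linarith
  have h12 : N = K p := by omega
  rw [Real.dist_eq, sub_zero, abs_of_nonneg (by positivity), ← h12, div_lt_iff₀ (by linarith)]
  nlinarith
end

section
/- Let K : ℕ → ℕ be a function with K(p) ≥ 1 for every prime p and K(p)/log p → 0 as p → ∞ along primes. Then there exists, for each prime p, a set A(p) ⊆ 𝔽_p such that, as p → ∞ along primes, |A(p)|/p → 1/2 and max{ |A(p) △ (a·A(p) + b)| / p : a, b ∈ ℤ, 1 ≤ |a| ≤ K(p), |b| ≤ K(p), p ∤ a } → 0. -/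
open Filter
open scoped symmDiff

lemma prod_ge_aux {ι : Type*} (s : Finset ι) (x : ι → ℝ) (h0 : ∀ i ∈ s, 0 ≤ x i)
    (h1 : ∀ i ∈ s, x i ≤ 1) :
    1 - ∑ i ∈ s, x i ≤ ∏ i ∈ s, (1 - x i) ∧ ∏ i ∈ s, (1 - x i) ≤ 1 := by
  classical
  induction s using Finset.induction_on with
  | empty => simp
  | insert a s ha ih =>
    rw [Finset.sum_insert ha, Finset.prod_insert ha]
    have ih' := ih (fun i hi => h0 i (Finset.mem_insert_of_mem hi))
      (fun i hi => h1 i (Finset.mem_insert_of_mem hi))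
    have h2 := h0 a (Finset.mem_insert_self a s)
    have h3 := h1 a (Finset.mem_insert_self a s)
    have h4 : 0 ≤ ∏ i ∈ s, (1 - x i) := Finset.prod_nonneg (fun i hi => by
      have := h1 i (Finset.mem_insert_of_mem hi); linarith)
    constructor <;> nlinarith [ih'.1, ih'.2]

lemma card_div_aux (m N : ℕ) (hm : m ≠ 0) (h : m.primeFactors ⊆ Nat.primesLE N) :
    (m.divisors.card : ℝ) = ∏ q ∈ Nat.primesLE N, ((m.factorization q : ℝ) + 1) := by
  rw [Nat.card_divisors hm]
  push_cast
  apply Finset.prod_subset h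
  intro q _ hq
  have : m.factorization q = 0 := by
    rw [← Finsupp.notMem_support_iff]; simpa using hq
  simp [this]

lemma nt_loss (N M a : ℕ) (hN : 2 ≤ N) (hM : 1 ≤ M) (ha : 1 ≤ a) (haN : a ≤ N) :
    (((Nat.lcmUpto N ^ M).divisors.filter (fun d => ¬ a * d ∣ Nat.lcmUpto N ^ M)).card : ℝ) ≤
      2 / M * ((Nat.lcmUpto N ^ M).divisors.card : ℝ) := by
  classical
  set n := Nat.lcmUpto N ^ M with hn
  have hW : Nat.lcmUpto N ≠ 0 := Nat.lcmUpto_ne_zero N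
  have hn0 : n ≠ 0 := pow_ne_zero _ hW
  have hlogN : 0 < Real.log N := Real.log_pos (by exact_mod_cast (by omega : 1 < N))
  have hM0 : (0:ℝ) < M := by exact_mod_cast hM
  have hfac : ∀ q ∈ Nat.primesLE N, n.factorization q = M * q.log N := by
    intro q hq
    have hqp : q.Prime := Nat.prime_of_mem_primesLE hq
    rw [hn, Nat.factorization_pow]
    simp [Nat.factorization_lcmUpto N hqp]
  have hva : ∀ q ∈ Nat.primesLE N, a.factorization q ≤ q.log N := fun q hq =>
    Nat.le_log_of_pow_le (Nat.prime_of_mem_primesLE hq).one_lt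
      ((Nat.le_of_dvd ha (Nat.ordProj_dvd a q)).trans haN)
  have hpa : a.primeFactors ⊆ Nat.primesLE N := by
    intro q hq
    rw [Nat.mem_primesLE]
    exact ⟨(Nat.le_of_dvd ha (Nat.dvd_of_mem_primeFactors hq)).trans haN, Nat.prime_of_mem_primeFactors hq⟩
  have hpn : n.primeFactors ⊆ Nat.primesLE N := by
    rw [hn, Nat.primeFactors_pow _ (by omega), Nat.primeFactors_lcmUpto]
  have han : a ∣ n := by
    have : a ∣ Nat.lcmUpto N := by
      rw [Nat.lcmUpto]
      exact Finset.dvd_lcm (f := id) (by simp; omega)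
    exact this.trans (dvd_pow_self _ (by omega))
  obtain ⟨m, hm⟩ := han
  have hm0 : m ≠ 0 := by rintro rfl; simp at hm; exact hn0 hm
  have ha0 : a ≠ 0 := by omega
  have hpm : m.primeFactors ⊆ Nat.primesLE N :=
    (Nat.primeFactors_mono (Dvd.intro_left a hm.symm) hn0).trans hpn
  have hfm : ∀ q, n.factorization q = a.factorization q + m.factorization q := by
    intro q; rw [hm, Nat.factorization_mul ha0 hm0]; simp
  have hset : n.divisors.filter (fun d => a * d ∣ n) = m.divisors := by
    ext d
    simp only [Finset.mem_filter, Nat.mem_divisors]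
    constructor
    · rintro ⟨_, h⟩
      rw [hm] at h
      exact ⟨Nat.dvd_of_mul_dvd_mul_left ha h, hm0⟩
    · rintro ⟨h, _⟩
      refine ⟨⟨h.trans (Dvd.intro_left a hm.symm), hn0⟩, ?_⟩
      rw [hm]; exact Nat.mul_dvd_mul_left a h
  have hsplit := Finset.card_filter_add_card_filter_not (s := n.divisors) (fun d => a * d ∣ n)
  rw [hset] at hsplit
  have hsplit' : (m.divisors.card : ℝ) +
    ((n.divisors.filter (fun d => ¬ a * d ∣ n)).card : ℝ) = n.divisors.card := by
    exact_mod_cast hsplit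
  set x : ℕ → ℝ := fun q => (a.factorization q : ℝ) / ((n.factorization q : ℝ) + 1) with hx
  have key := (prod_ge_aux (Nat.primesLE N) x (fun q _ => by positivity) (fun q _ => by
    rw [hx]; simp only
    rw [div_le_one (by positivity), hfm q]; push_cast
    have : (0:ℝ) ≤ m.factorization q := by positivity
    linarith)).1
  have hmn : (m.divisors.card : ℝ) = n.divisors.card * ∏ q ∈ Nat.primesLE N, (1 - x q) := by
    rw [card_div_aux m N hm0 hpm, card_div_aux n N hn0 hpn, ← Finset.prod_mul_distrib]
    apply Finset.prod_congr rfl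
    intro q _
    have h1 : ((n.factorization q : ℝ) + 1) ≠ 0 := by positivity
    rw [hx]; simp only
    rw [mul_sub, mul_div_cancel₀ _ h1, hfm q]; push_cast; ring
  have hsum : ∑ q ∈ Nat.primesLE N, x q ≤ 2 / M := by
    have hterm : ∀ q ∈ Nat.primesLE N,
        x q ≤ (2 / (M * Real.log N)) * (a.factorization q * Real.log q) := by
      intro q hq
      have hqp : q.Prime := Nat.prime_of_mem_primesLE hq
      have hqN : q ≤ N := (Nat.mem_primesLE.1 hq).1
      have hlq : 0 < Real.log q := Real.log_pos (by exact_mod_cast hqp.one_lt)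
      have hk1 : 1 ≤ q.log N := Nat.log_pos hqp.one_lt hqN
      have hlt : N < q ^ (q.log N + 1) := Nat.lt_pow_succ_log_self hqp.one_lt N
      have hl : Real.log N ≤ (q.log N + 1) * Real.log q := by
        have : Real.log N ≤ Real.log ((q:ℝ) ^ (q.log N + 1)) :=
          Real.log_le_log (by positivity) (by exact_mod_cast hlt.le)
        rw [Real.log_pow] at this
        exact_mod_cast this
      have hk1' : (1:ℝ) ≤ q.log N := by exact_mod_cast hk1
      have hl2 : Real.log N ≤ 2 * q.log N * Real.log q := by nlinarith
      rw [hx]; simp only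
      rw [hfac q hq, div_le_iff₀ (by positivity)]
      have hc : (1:ℝ) ≤ 2 / (M * Real.log N) * Real.log q * ((M * q.log N : ℕ) + 1) := by
        rw [div_mul_eq_mul_div, div_mul_eq_mul_div, one_le_div (by positivity)]
        push_cast
        nlinarith [mul_le_mul_of_nonneg_left hl2 hM0.le]
      have hv : (0:ℝ) ≤ a.factorization q := by positivity
      calc (a.factorization q : ℝ) = a.factorization q * 1 := by ring
        _ ≤ a.factorization q * (2 / (M * Real.log N) * Real.log q * ((M * q.log N : ℕ) + 1)) :=
          mul_le_mul_of_nonneg_left hc hv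
        _ = _ := by ring
    refine (Finset.sum_le_sum hterm).trans ?_
    rw [← Finset.mul_sum]
    have hloga : ∑ q ∈ Nat.primesLE N, (a.factorization q * Real.log q) = Real.log a := by
      have h1 : Real.log a = ∑ q ∈ a.primeFactors, (a.factorization q * Real.log q) := by
        rw [Real.log_nat_eq_sum_factorization]; rfl
      rw [h1]
      symm
      apply Finset.sum_subset hpa
      intro q _ hq
      have : a.factorization q = 0 := by
        rw [← Finsupp.notMem_support_iff]; simpa using hq
      simp [this]
    rw [hloga]
    have : Real.log a ≤ Real.log N := Real.log_le_log (by exact_mod_cast ha) (by exact_mod_cast haN)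
    calc 2 / (M * Real.log N) * Real.log a ≤ 2 / (M * Real.log N) * Real.log N := by gcongr
      _ = 2 / M := by field_simp
  have hd : (0:ℝ) ≤ n.divisors.card := by positivity
  have : (n.divisors.card : ℝ) * (1 - 2 / M) ≤ m.divisors.card := by
    rw [hmn]; apply mul_le_mul_of_nonneg_left _ hd; linarith
  nlinarith

def AA (p : ℕ) [NeZero p] (S : Finset (ZMod p)) (c : ZMod p) (L : ℕ) : Finset (ZMod p) :=
  Finset.univ.filter (fun x => ∃ r ∈ S, (r * x - c).val < L)

lemma card_val_lt (p : ℕ) [NeZero p] (L : ℕ) :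
    (Finset.univ.filter (fun y : ZMod p => y.val < L)).card ≤ L := by
  calc _ ≤ (Finset.range L).card := Finset.card_le_card_of_injOn ZMod.val
        (by intro y hy; simpa using hy) (fun x _ y _ h => ZMod.val_injective p h)
    _ = L := by simp

lemma card_val_lt_eq (p : ℕ) [NeZero p] (L : ℕ) (hL : L ≤ p) :
    (Finset.univ.filter (fun y : ZMod p => y.val < L)).card = L := by
  apply le_antisymm (card_val_lt p L)
  calc L = (Finset.range L).card := by simp
    _ ≤ _ := Finset.card_le_card_of_injOn (fun i : ℕ => (i : ZMod p))
        (by intro i hi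
            simp only [Finset.coe_range, Set.mem_Iio] at hi
            simp [ZMod.val_natCast_of_lt (hi.trans_le hL), hi])
        (by intro i hi j hj h
            simp only [Finset.coe_range, Set.mem_Iio] at hi hj
            have := congrArg ZMod.val h
            simpa [ZMod.val_natCast_of_lt (hi.trans_le hL), ZMod.val_natCast_of_lt (hj.trans_le hL)] using this)

/-- pull back a predicate along an affine bijection -/
lemma card_affine (p : ℕ) [Fact p.Prime] (r c : ZMod p) (hr : r ≠ 0) (P : ZMod p → Prop)
    [DecidablePred P] :
    (Finset.univ.filter (fun x : ZMod p => P (r * x - c))).card =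
      (Finset.univ.filter (fun y : ZMod p => P y)).card := by
  apply Finset.card_bij (fun x _ => r * x - c)
  · intro x hx; simpa using hx
  · intro x _ y _ h
    exact mul_left_cancel₀ hr (sub_left_injective h)
  · intro y hy
    refine ⟨r⁻¹ * (y + c), ?_, ?_⟩
    · simp only [Finset.mem_filter, Finset.mem_univ, true_and] at hy ⊢
      rw [mul_inv_cancel_left₀ hr]; simpa using hy
    · rw [mul_inv_cancel_left₀ hr]; ring

lemma AA_sdiff (p : ℕ) [Fact p.Prime] (S S' : Finset (ZMod p)) (c : ZMod p) (L : ℕ)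
    (h0 : (0 : ZMod p) ∉ S) :
    (AA p S c L \ AA p S' c L).card ≤ (S \ S').card * L := by
  classical
  have : AA p S c L \ AA p S' c L ⊆
      (S \ S').biUnion (fun r => Finset.univ.filter (fun x : ZMod p => (r * x - c).val < L)) := by
    intro x hx
    simp only [AA, Finset.mem_sdiff, Finset.mem_filter, Finset.mem_univ, true_and,
      Finset.mem_biUnion] at hx ⊢
    obtain ⟨⟨r, hr, hx1⟩, hx2⟩ := hx
    exact ⟨r, ⟨hr, fun h => hx2 ⟨r, h, hx1⟩⟩, hx1⟩
  refine (Finset.card_le_card this).trans (Finset.card_biUnion_le_card_mul _ _ _ ?_)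
  intro r hr
  have hr0 : r ≠ 0 := by rintro rfl; exact h0 (Finset.mem_sdiff.1 hr).1
  rw [card_affine p r c hr0 (fun y => y.val < L)]
  exact card_val_lt p L

lemma AA_dil (p : ℕ) [Fact p.Prime] (S : Finset (ZMod p)) (c : ZMod p) (L l : ℕ)
    (h0 : (0 : ZMod p) ∉ S) (a : ZMod p) (ha : a ≠ 0)
    (hl : (S.filter (fun r => a * r ∉ S)).card ≤ l) :
    (AA p S c L ∆ (AA p S c L).image (fun x => a * x)).card ≤ 2 * l * L := by
  classical
  set S' := S.image (fun r => a⁻¹ * r) with hS'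
  have hinj : Function.Injective (fun r : ZMod p => a⁻¹ * r) :=
    mul_right_injective₀ (inv_ne_zero ha)
  have him : (AA p S c L).image (fun x => a * x) = AA p S' c L := by
    ext x
    simp only [AA, hS', Finset.mem_image, Finset.mem_filter, Finset.mem_univ, true_and]
    constructor
    · rintro ⟨y, ⟨r, hr, hy⟩, rfl⟩
      refine ⟨_, ⟨r, hr, rfl⟩, ?_⟩
      have : a⁻¹ * r * (a * y) = r * y := by field_simp
      rwa [this]
    · rintro ⟨_, ⟨r, hr, rfl⟩, h⟩
      refine ⟨a⁻¹ * x, ⟨r, hr, ?_⟩, by field_simp⟩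
      have : r * (a⁻¹ * x) = a⁻¹ * r * x := by ring
      rwa [this]
  have h0' : (0 : ZMod p) ∉ S' := by
    rw [hS']; simp only [Finset.mem_image, not_exists, not_and]
    intro r hr h
    rcases mul_eq_zero.1 h with h | h
    · exact inv_ne_zero ha h
    · exact h0 (h ▸ hr)
  have hc : S'.card = S.card := Finset.card_image_of_injective _ hinj
  have h1 : (S \ S').card ≤ l := by
    refine le_trans (Finset.card_le_card ?_) hl
    intro r hr
    rw [Finset.mem_sdiff] at hr
    rw [Finset.mem_filter]
    refine ⟨hr.1, fun h => hr.2 ?_⟩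
    rw [hS', Finset.mem_image]
    exact ⟨a * r, h, by field_simp⟩
  have h2 : (S' \ S).card ≤ l := by
    rw [Finset.card_sdiff_comm hc]; exact h1
  rw [him]
  have := AA_sdiff p S S' c L h0
  have := AA_sdiff p S' S c L h0'
  calc _ ≤ (AA p S c L \ AA p S' c L).card + (AA p S' c L \ AA p S c L).card :=
        Finset.card_union_le _ _
    _ ≤ l * L + l * L := by
        gcongr
        · exact (AA_sdiff p S S' c L h0).trans (Nat.mul_le_mul_right _ h1)
        · exact (AA_sdiff p S' S c L h0').trans (Nat.mul_le_mul_right _ h2)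
    _ = _ := by ring

lemma shift_card (p : ℕ) [Fact p.Prime] (L T : ℕ) (hL : L ≤ p) (τ : ℤ) (hτ : |τ| ≤ T) :
    (Finset.univ.filter (fun y : ZMod p => y.val < L ∧ ¬ (y - (τ : ZMod p)).val < L)).card
      ≤ 2 * T := by
  classical
  calc _ ≤ (Finset.range T ∪ Finset.Ico (L - T) L).card := by
        apply Finset.card_le_card_of_injOn ZMod.val _ (fun x _ y _ h => ZMod.val_injective p h)
        intro y hy
        simp only [Finset.coe_filter, Finset.mem_univ, true_and, Set.mem_ofPred_eq] at hy
        obtain ⟨h1, h2⟩ := hy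
        simp only [Finset.coe_union, Finset.coe_range, Finset.coe_Ico, Set.mem_union, Set.mem_Iio,
          Set.mem_Ico]
        by_contra hcon
        push Not at hcon
        obtain ⟨h3, h4⟩ := hcon
        apply h2
        have h5 : y.val < L - T := by by_contra h; push Not at h; have := h4 h; omega
        rw [abs_le] at hτ
        obtain ⟨k, hk⟩ : ∃ k : ℕ, (y.val : ℤ) - τ = k := ⟨((y.val : ℤ) - τ).toNat, by omega⟩
        have hy' : y - (τ : ZMod p) = (k : ZMod p) := by
          have : ((k : ℤ) : ZMod p) = (((y.val : ℤ) - τ : ℤ) : ZMod p) := by rw [hk]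
          push_cast at this
          rw [this]; simp
        rw [hy', ZMod.val_natCast_of_lt (by omega)]
        omega
    _ ≤ T + (L - (L - T)) := by
        refine (Finset.card_union_le _ _).trans ?_
        simp
    _ ≤ 2 * T := by omega

lemma AA_trans (p : ℕ) [Fact p.Prime] (S : Finset (ZMod p)) (c : ZMod p) (L T : ℕ)
    (hL : L ≤ p) (h0 : (0 : ZMod p) ∉ S) (b : ZMod p)
    (hb : ∀ r ∈ S, ∃ τ : ℤ, |τ| ≤ T ∧ r * b = (τ : ZMod p)) :
    (Finset.univ.filter (fun x => x ∈ AA p S c L ∧ x - b ∉ AA p S c L)).card ≤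
      S.card * (2 * T) := by
  classical
  have : Finset.univ.filter (fun x => x ∈ AA p S c L ∧ x - b ∉ AA p S c L) ⊆
      S.biUnion (fun r => Finset.univ.filter
        (fun x : ZMod p => (r * x - c).val < L ∧ ¬ ((r * x - c) - r * b).val < L)) := by
    intro x hx
    simp only [AA, Finset.mem_filter, Finset.mem_univ, true_and,
      Finset.mem_biUnion] at hx ⊢
    obtain ⟨⟨r, hr, hx1⟩, hx2⟩ := hx
    refine ⟨r, hr, hx1, fun h => hx2 ⟨r, hr, ?_⟩⟩
    have : r * (x - b) - c = r * x - c - r * b := by ring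
    rwa [this]
  refine (Finset.card_le_card this).trans (Finset.card_biUnion_le_card_mul _ _ _ ?_)
  intro r hr
  have hr0 : r ≠ 0 := by rintro rfl; exact h0 hr
  rw [card_affine p r c hr0 (fun y => y.val < L ∧ ¬ (y - r * b).val < L)]
  obtain ⟨τ, hτ, he⟩ := hb r hr
  rw [he]
  exact shift_card p L T hL τ hτ

lemma AA_aff (p : ℕ) [Fact p.Prime] (S : Finset (ZMod p)) (c : ZMod p) (L T l : ℕ)
    (hL : L ≤ p) (h0 : (0 : ZMod p) ∉ S) (a b : ZMod p) (ha : a ≠ 0)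
    (hl : (S.filter (fun r => a * r ∉ S)).card ≤ l)
    (hb : ∀ r ∈ S, ∃ τ : ℤ, |τ| ≤ T ∧ r * b = (τ : ZMod p)) :
    (AA p S c L ∆ (AA p S c L).image (fun x => a * x + b)).card ≤
      2 * l * L + 4 * T * S.card := by
  classical
  set A := AA p S c L with hA
  have hb' : ∀ r ∈ S, ∃ τ : ℤ, |τ| ≤ T ∧ r * (-b) = (τ : ZMod p) := by
    intro r hr
    obtain ⟨τ, h1, h2⟩ := hb r hr
    exact ⟨-τ, by rwa [abs_neg], by push_cast; rw [← h2]; ring⟩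
  have t1 := AA_trans p S c L T hL h0 b hb
  have t2 := AA_trans p S c L T hL h0 (-b) hb'
  have t3 := AA_dil p S c L l h0 a ha hl
  rw [← hA] at t1 t2 t3
  have hsub : A ∆ A.image (fun x => a * x + b) ⊆
      (Finset.univ.filter (fun x => x ∈ A ∧ x - b ∉ A) ∪
       (Finset.univ.filter (fun x => x ∈ A ∧ x - (-b) ∉ A)).image (fun x => x + b)) ∪
       (A ∆ A.image (fun x => a * x)).image (fun x => x + b) := by
    intro x hx
    have e1 : x ∈ A.image (fun x => a * x + b) ↔ x - b ∈ A.image (fun x => a * x) := by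
      simp only [Finset.mem_image]
      constructor
      · rintro ⟨y, hy, rfl⟩; exact ⟨y, hy, by ring⟩
      · rintro ⟨y, hy, h⟩; exact ⟨y, hy, by rw [h]; ring⟩
    have e2 : ∀ B : Finset (ZMod p), x ∈ B.image (fun x => x + b) ↔ x - b ∈ B := by
      intro B
      simp only [Finset.mem_image]
      constructor
      · rintro ⟨y, hy, rfl⟩; simpa using hy
      · intro h; exact ⟨_, h, by ring⟩
    rw [Finset.mem_symmDiff, e1] at hx
    rw [Finset.mem_union, Finset.mem_union, e2, e2, Finset.mem_symmDiff]
    simp only [Finset.mem_filter, Finset.mem_univ, true_and, sub_neg_eq_add, sub_add_cancel]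
    tauto
  have := Finset.card_le_card hsub
  have u1 := Finset.card_union_le (Finset.univ.filter (fun x => x ∈ A ∧ x - b ∉ A) ∪
       (Finset.univ.filter (fun x => x ∈ A ∧ x - (-b) ∉ A)).image (fun x => x + b))
       ((A ∆ A.image (fun x => a * x)).image (fun x => x + b))
  have u2 := Finset.card_union_le (Finset.univ.filter (fun x => x ∈ A ∧ x - b ∉ A))
       ((Finset.univ.filter (fun x => x ∈ A ∧ x - (-b) ∉ A)).image (fun x => x + b))
  have i1 : ((Finset.univ.filter (fun x => x ∈ A ∧ x - (-b) ∉ A)).image (fun x => x + b)).card ≤ _ :=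
    Finset.card_image_le
  have i2 : ((A ∆ A.image (fun x => a * x)).image (fun x => x + b)).card ≤ _ :=
    Finset.card_image_le
  nlinarith

lemma AA_exists (p : ℕ) [Fact p.Prime] (S : Finset (ZMod p)) (L : ℕ)
    (hL : L ≤ p) (hL1 : 1 ≤ L) (h0 : (0 : ZMod p) ∉ S) (hS : S.Nonempty) (hsL : p ≤ S.card * L) :
    ∃ c, p ≤ 2 * (AA p S c L).card := by
  classical
  by_contra hcon
  push Not at hcon
  set s := S.card with hs
  have hp : 0 < p := (Fact.out : p.Prime).pos
  let E : ZMod p → ZMod p × ZMod p → ℕ := fun r z => if (r * z.2 - z.1).val < L then 1 else 0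
  let Z : ZMod p × ZMod p → ℕ := fun z => ∑ r ∈ S, E r z
  have hE1 : ∀ r, r ≠ 0 → ∑ z, E r z = p * L := by
    intro r hr
    rw [Fintype.sum_prod_type]
    have : ∀ c : ZMod p, ∑ x, E r (c, x) = L := by
      intro c
      simp only [E]
      rw [Finset.sum_boole, card_affine p r c hr (fun y => y.val < L), card_val_lt_eq p L hL]
      rfl
    simp [this, ZMod.card]
  have hE2 : ∀ r r', r ≠ r' → ∑ z, E r z * E r' z = L * L := by
    intro r r' hrr
    simp only [E, ← ite_and, mul_ite, mul_one, mul_zero]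
    rw [Finset.sum_boole]
    have hd : r - r' ≠ 0 := sub_ne_zero.2 hrr
    have : (Finset.univ.filter (fun z : ZMod p × ZMod p => (r' * z.2 - z.1).val < L ∧ (r * z.2 - z.1).val < L)).card
       = ((Finset.univ.filter (fun y : ZMod p => y.val < L)) ×ˢ (Finset.univ.filter (fun y : ZMod p => y.val < L))).card := by
      apply Finset.card_bij (fun z _ => (r' * z.2 - z.1, r * z.2 - z.1))
      · intro z hz; simpa using hz
      · rintro ⟨c, x⟩ _ ⟨c', x'⟩ _ h
        simp only [Prod.mk.injEq] at h ⊢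
        obtain ⟨h1, h2⟩ := h
        have : (r - r') * x = (r - r') * x' := by linear_combination h2 - h1
        have hx := mul_left_cancel₀ hd this
        subst hx
        exact ⟨by linear_combination -h1, rfl⟩
      · rintro ⟨i, j⟩ hij
        refine ⟨(r' * ((r - r')⁻¹ * (j - i)) - i, (r - r')⁻¹ * (j - i)), ?_, ?_⟩
        all_goals
          have e : r * ((r - r')⁻¹ * (j - i)) - (r' * ((r - r')⁻¹ * (j - i)) - i) = j := by
            field_simp; ring
        · simp only [Finset.mem_product, Finset.mem_filter, Finset.mem_univ, true_and] at hij ⊢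
          rw [e]; simpa using hij
        · simp only [Prod.mk.injEq]
          exact ⟨by ring, e⟩
    rw [this, Finset.card_product, card_val_lt_eq p L hL]; rfl
  have hZ1 : ∑ z, Z z = s * (p * L) := by
    simp only [Z]
    rw [Finset.sum_comm]
    rw [Finset.sum_congr rfl (fun r hr => hE1 r (by rintro rfl; exact h0 hr))]
    simp [hs]
  have hZ2 : ∑ z, Z z * Z z ≤ s * (p * L) + s * s * (L * L) := by
    simp only [Z, Finset.sum_mul_sum]
    rw [Finset.sum_comm]
    have : ∀ r ∈ S, ∑ z, ∑ r' ∈ S, E r z * E r' z ≤ p * L + s * (L * L) := by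
      intro r hr
      rw [Finset.sum_comm]
      have hr0 : r ≠ 0 := by rintro rfl; exact h0 hr
      calc _ ≤ ∑ r' ∈ S, ((if r = r' then p * L else 0) + L * L) := by
            apply Finset.sum_le_sum
            intro r' _
            by_cases h : r = r'
            · subst h
              simp only [if_true]
              have : ∀ z, E r z * E r z = E r z := by intro z; simp only [E]; split_ifs <;> simp
              simp only [this, hE1 r hr0]; omega
            · rw [hE2 r r' h]; simp
        _ = _ := by
            rw [Finset.sum_add_distrib, Finset.sum_ite_eq]; simp [hr, hs]
    calc _ ≤ ∑ r ∈ S, (p * L + s * (L * L)) := Finset.sum_le_sum this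
      _ = _ := by simp [← hs]; ring
  let G : Finset (ZMod p × ZMod p) := Finset.univ.filter (fun z => z.2 ∈ AA p S z.1 L)
  have hZG : ∀ z, z ∉ G → Z z = 0 := by
    intro z hz
    simp only [G, AA, Finset.mem_filter, Finset.mem_univ, true_and, not_exists, not_and] at hz
    apply Finset.sum_eq_zero
    intro r hr
    simp only [E]; rw [if_neg (hz r hr)]
  have hGs : ∑ z ∈ G, Z z = ∑ z, Z z :=
    Finset.sum_subset (Finset.subset_univ _) (fun z _ hz => hZG z hz)
  have hCS : (∑ z ∈ G, Z z) ^ 2 ≤ G.card * ∑ z ∈ G, Z z ^ 2 := sq_sum_le_card_mul_sum_sq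
  have hGs2 : ∑ z ∈ G, Z z ^ 2 ≤ s * (p * L) + s * s * (L * L) := by
    refine le_trans ?_ hZ2
    simp only [sq]
    exact Finset.sum_le_sum_of_subset (Finset.subset_univ _)
  have hGc : G.card = ∑ c, (AA p S c L).card := by
    simp only [G, Finset.card_filter]
    rw [Fintype.sum_prod_type]
    apply Finset.sum_congr rfl
    intro c _
    rw [Finset.sum_boole]; simp
  have hG2 : 2 * G.card < p * p := by
    rw [hGc, Finset.mul_sum]
    calc _ < ∑ c : ZMod p, p := Finset.sum_lt_sum_of_nonempty Finset.univ_nonempty (fun c _ => hcon c)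
      _ = p * p := by simp [ZMod.card]
  rw [hGs, hZ1] at hCS
  have hspos : 0 < s := Finset.card_pos.2 hS
  set u := s * L with hu
  have hupos : 0 < u := Nat.mul_pos hspos hL1
  have h1 : (p * u) * (p * u) ≤ G.card * (u * (p + u)) := by
    calc _ = (s * (p * L)) ^ 2 := by rw [hu]; ring
      _ ≤ _ := hCS.trans (Nat.mul_le_mul_left _ hGs2)
      _ = _ := by rw [hu]; ring
  have h2 : G.card * (u * (p + u)) ≤ G.card * (u * (2 * u)) := by gcongr; omega
  have h3 : (p * p) * (u * u) ≤ (2 * G.card) * (u * u) := by nlinarith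
  have h4 := Nat.le_of_mul_le_mul_right h3 (Nat.mul_pos hupos hupos)
  omega

lemma AA_succ (p : ℕ) [Fact p.Prime] (S : Finset (ZMod p)) (c : ZMod p) (L : ℕ)
    (h0 : (0 : ZMod p) ∉ S) :
    (AA p S c (L+1)).card ≤ (AA p S c L).card + S.card := by
  classical
  have : AA p S c (L+1) ⊆ AA p S c L ∪
      S.biUnion (fun r => Finset.univ.filter (fun x : ZMod p => (r * x - c).val = L)) := by
    intro x hx
    simp only [AA, Finset.mem_union, Finset.mem_filter, Finset.mem_univ, true_and,
      Finset.mem_biUnion] at hx ⊢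
    obtain ⟨r, hr, hx1⟩ := hx
    rcases Nat.lt_succ_iff_lt_or_eq.1 hx1 with h | h
    · exact Or.inl ⟨r, hr, h⟩
    · exact Or.inr ⟨r, hr, h⟩
  refine (Finset.card_le_card this).trans ((Finset.card_union_le _ _).trans ?_)
  apply Nat.add_le_add_left
  refine (Finset.card_biUnion_le_card_mul S _ 1 ?_).trans (Nat.mul_one _).le
  intro r hr
  have hr0 : r ≠ 0 := by rintro rfl; exact h0 hr
  rw [card_affine p r c hr0 (fun y => y.val = L), Finset.card_le_one]
  intro x hx y hy
  simp only [Finset.mem_filter, Finset.mem_univ, true_and] at hx hy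
  exact ZMod.val_injective p (hx.trans hy.symm)

lemma AA_half (p : ℕ) [Fact p.Prime] (S : Finset (ZMod p))
    (h0 : (0 : ZMod p) ∉ S) (hS : 2 ≤ S.card) :
    ∃ c L, L ≤ p ∧ S.card * L ≤ p + S.card ∧ p ≤ 2 * (AA p S c L).card ∧
      2 * (AA p S c L).card ≤ p + 2 * S.card := by
  classical
  have hp : 2 ≤ p := (Fact.out : p.Prime).two_le
  set s := S.card with hs
  have hdm := Nat.div_add_mod p s
  have hml := Nat.mod_lt p (by omega : 0 < s)
  have hL0 : p / s + 1 ≤ p := by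
    have : p / s < p := Nat.div_lt_self (by omega) (by omega)
    omega
  obtain ⟨c, hc⟩ := AA_exists p S (p / s + 1) hL0 (Nat.le_add_left 1 _) h0 (Finset.card_pos.1 (by rw [← hs]; omega))
    (by rw [← hs, mul_add, mul_one]; omega)
  have hex : ∃ L, p ≤ 2 * (AA p S c L).card := ⟨_, hc⟩
  have hmin : Nat.find hex ≤ p / s + 1 := Nat.find_min' hex hc
  have hspec := Nat.find_spec hex
  refine ⟨c, Nat.find hex, hmin.trans hL0, ?_, hspec, ?_⟩
  · calc s * Nat.find hex ≤ s * (p / s + 1) := Nat.mul_le_mul_left _ hmin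
      _ ≤ _ := by rw [mul_add, mul_one]; have := Nat.mul_div_le p s; omega
  · rcases Nat.eq_zero_or_pos (Nat.find hex) with h | h
    · rw [h]; simp [AA]
    · have h1 := Nat.find_min hex (Nat.sub_lt h one_pos)
      have h2 := AA_succ p S c (Nat.find hex - 1) h0
      rw [Nat.sub_add_cancel h] at h2
      omega

lemma core (p N M : ℕ) (hpp : p.Prime) (hN : 2 ≤ N) (hM : 1 ≤ M)
    (hbig : 8 * (Nat.lcmUpto N ^ M) ^ 2 * N * M ≤ p) :
    ∃ A : Finset (ZMod p), |(A.card : ℝ) / p - 1 / 2| ≤ 1 / M ∧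
      ∀ a b : ℤ, 1 ≤ |a| → |a| ≤ (N : ℤ) → |b| ≤ (N : ℤ) →
        ((A ∆ (A.image fun x => (a : ZMod p) * x + (b : ZMod p))).card : ℝ) / p ≤ 17 / M := by
  classical
  haveI : Fact p.Prime := ⟨hpp⟩
  set n := Nat.lcmUpto N ^ M with hn
  have hn0 : 0 < n := pow_pos (Nat.lcmUpto_pos N) _
  have hn2 : n ≤ n ^ 2 := by nlinarith
  have hnN : n * N ≤ n ^ 2 * N := Nat.mul_le_mul_right _ hn2
  have hnNM : n ^ 2 * N ≤ n ^ 2 * N * M := Nat.le_mul_of_pos_right _ hM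
  have hNp : 8 * N ≤ p := by nlinarith
  have hnp : 16 * n ≤ p := by nlinarith
  set D := n.divisors with hD
  set S1 : Finset (ZMod p) := D.image (fun d : ℕ => (d : ZMod p)) with hS1
  set S2 : Finset (ZMod p) := D.image (fun d : ℕ => -(d : ZMod p)) with hS2
  set S := S1 ∪ S2 with hS
  have hDle : ∀ d ∈ D, 0 < d ∧ d ≤ n := by
    intro d hd
    exact ⟨Nat.pos_of_mem_divisors hd, Nat.divisor_le hd⟩
  have hval : ∀ d ∈ D, ((d : ZMod p)).val = d := fun d hd =>
    ZMod.val_natCast_of_lt (by have := hDle d hd; omega)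
  have hcard1 : S1.card = D.card := Finset.card_image_of_injOn (by
    intro d hd e he h
    have := congrArg ZMod.val h
    simpa only [hval d hd, hval e he] using this)
  have hne0 : ∀ d ∈ D, (d : ZMod p) ≠ 0 := by
    intro d hd h
    have := congrArg ZMod.val h
    rw [hval d hd, ZMod.val_zero] at this
    have := hDle d hd; omega
  have hDS : D.card ≤ S.card := hcard1 ▸ Finset.card_le_card Finset.subset_union_left
  have hSD : S.card ≤ 2 * n := by
    have h1 : S.card ≤ S1.card + S2.card := Finset.card_union_le _ _
    have h2 : S2.card ≤ D.card := Finset.card_image_le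
    have h3 : D.card ≤ n := Nat.card_divisors_le_self n
    omega
  have h0S : (0 : ZMod p) ∉ S := by
    rw [hS, Finset.mem_union, hS1, hS2, Finset.mem_image, Finset.mem_image]
    rintro (⟨d, hd, h⟩ | ⟨d, hd, h⟩)
    · exact hne0 d hd h
    · exact hne0 d hd (neg_eq_zero.1 h)
  have hS2' : 2 ≤ S.card := by
    have h1 : (1 : ZMod p) ∈ S := by
      apply Finset.mem_union_left
      exact Finset.mem_image.2 ⟨1, by simp [hD]; omega, by simp⟩
    have h2 : (-1 : ZMod p) ∈ S := by
      apply Finset.mem_union_right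
      exact Finset.mem_image.2 ⟨1, by simp [hD]; omega, by simp⟩
    have hne : (1 : ZMod p) ≠ -1 := by
      haveI : Fact (2 < p) := ⟨by omega⟩
      exact (ZMod.neg_one_ne_one).symm
    exact Finset.one_lt_card.2 ⟨_, h1, _, h2, hne⟩
  obtain ⟨c, L, hLp, hsL, hc1, hc2⟩ := AA_half p S h0S hS2'
  have hp0 : (0:ℝ) < p := by exact_mod_cast hpp.pos
  have hM0 : (0:ℝ) < M := by exact_mod_cast hM
  have hbigR : 8 * (n:ℝ) ^ 2 * N * M ≤ p := by exact_mod_cast hbig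
  have hSR : (S.card : ℝ) ≤ 2 * n := by exact_mod_cast hSD
  have hnNR : (n:ℝ) ≤ n ^ 2 := by exact_mod_cast hn2
  have hNR : (2:ℝ) ≤ N := by exact_mod_cast hN
  have hnR : (0:ℝ) < n := by exact_mod_cast hn0
  refine ⟨AA p S c L, ?_, ?_⟩
  · have h1 : (p : ℝ) ≤ 2 * ((AA p S c L).card : ℝ) := by exact_mod_cast hc1
    have h2 : 2 * ((AA p S c L).card : ℝ) ≤ p + 2 * S.card := by exact_mod_cast hc2
    have e : ((AA p S c L).card : ℝ) / p - 1 / 2 = (2 * (AA p S c L).card - p) / (2 * p) := by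
      field_simp
    have hnn : (n:ℝ) ≤ n ^ 2 * N := by nlinarith
    rw [e, abs_of_nonneg (div_nonneg (by linarith) (by linarith)), div_le_div_iff₀ (by positivity) hM0]
    have : (S.card : ℝ) * M ≤ 2 * (n ^ 2 * N) * M := by
      apply mul_le_mul_of_nonneg_right _ hM0.le; linarith
    nlinarith
  · intro a b ha1 haN hbN
    set α := a.natAbs with hα
    have hαa : (α : ℤ) = |a| := Int.natCast_natAbs a
    have hα1 : 1 ≤ α := by omega
    have hαN : α ≤ N := by omega
    have haZ : (a : ZMod p) = α ∨ (a : ZMod p) = -α := by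
      rcases Int.natAbs_eq a with h | h
      · left; rw [h]; push_cast; simp [hα]
      · right; rw [h]; push_cast; simp [hα]
    have ha0 : (a : ZMod p) ≠ 0 := by
      have : (α : ZMod p) ≠ 0 := by
        intro h
        have := congrArg ZMod.val h
        rw [ZMod.val_natCast_of_lt (by omega), ZMod.val_zero] at this
        omega
      rcases haZ with h | h <;> rw [h]
      · exact this
      · exact neg_ne_zero.2 this
    set B := D.filter (fun d => ¬ α * d ∣ n) with hB
    have hloss : (B.card : ℝ) ≤ 2 / M * D.card := nt_loss N M α hN hM hα1 hαN
    have hl : (S.filter (fun r => (a : ZMod p) * r ∉ S)).card ≤ 2 * B.card := by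
      have hsub : S.filter (fun r => (a : ZMod p) * r ∉ S) ⊆
          B.image (fun d : ℕ => (d : ZMod p)) ∪ B.image (fun d : ℕ => -(d : ZMod p)) := by
        have hin : ∀ d ∈ D, α * d ∣ n → ((α : ZMod p) * d ∈ S ∧ -((α : ZMod p) * d) ∈ S) := by
          intro d hd h
          have : α * d ∈ D := Nat.mem_divisors.2 ⟨h, hn0.ne'⟩
          constructor
          · exact Finset.mem_union_left _ (Finset.mem_image.2 ⟨_, this, by push_cast; rfl⟩)
          · exact Finset.mem_union_right _ (Finset.mem_image.2 ⟨_, this, by push_cast; rfl⟩)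
        intro r hr
        obtain ⟨hrS, hr2⟩ := Finset.mem_filter.1 hr
        rcases Finset.mem_union.1 hrS with h | h
        · obtain ⟨d, hd, rfl⟩ := Finset.mem_image.1 h
          refine Finset.mem_union_left _ (Finset.mem_image.2 ⟨d, Finset.mem_filter.2 ⟨hd, ?_⟩, rfl⟩)
          intro hdv
          apply hr2
          rcases haZ with h | h <;> rw [h]
          · exact (hin d hd hdv).1
          · rw [neg_mul]; exact (hin d hd hdv).2
        · obtain ⟨d, hd, rfl⟩ := Finset.mem_image.1 h
          refine Finset.mem_union_right _ (Finset.mem_image.2 ⟨d, Finset.mem_filter.2 ⟨hd, ?_⟩, rfl⟩)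
          intro hdv
          apply hr2
          rcases haZ with h | h <;> rw [h]
          · rw [mul_neg]; exact (hin d hd hdv).2
          · rw [neg_mul_neg]; exact (hin d hd hdv).1
      have h1 := Finset.card_le_card hsub
      have h2 := Finset.card_union_le (B.image (fun d : ℕ => (d : ZMod p)))
        (B.image (fun d : ℕ => -(d : ZMod p)))
      have h3 : (B.image (fun d : ℕ => (d : ZMod p))).card ≤ B.card := Finset.card_image_le
      have h4 : (B.image (fun d : ℕ => -(d : ZMod p))).card ≤ B.card := Finset.card_image_le
      omega
    have hb : ∀ r ∈ S, ∃ τ : ℤ, |τ| ≤ ((n * N : ℕ) : ℤ) ∧ r * (b : ZMod p) = (τ : ZMod p) := by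
      intro r hr
      have hle : ∀ d ∈ D, |(d : ℤ) * b| ≤ ((n * N : ℕ) : ℤ) := by
        intro d hd
        rw [abs_mul]; push_cast
        have := (hDle d hd).2
        have h' : |(d : ℤ)| ≤ n := by rw [abs_of_nonneg (by positivity)]; exact_mod_cast this
        exact mul_le_mul h' hbN (abs_nonneg _) (by positivity)
      rcases Finset.mem_union.1 hr with h | h
      · obtain ⟨d, hd, rfl⟩ := Finset.mem_image.1 h
        exact ⟨d * b, hle d hd, by push_cast; rfl⟩
      · obtain ⟨d, hd, rfl⟩ := Finset.mem_image.1 h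
        exact ⟨-(d * b), by rw [abs_neg]; exact hle d hd, by push_cast; ring⟩
    have hfin := AA_aff p S c L (n * N) (2 * B.card) hLp h0S a b ha0 hl hb
    have hfinR : ((AA p S c L ∆ ((AA p S c L).image fun x => (a : ZMod p) * x + (b : ZMod p))).card : ℝ)
        ≤ 2 * (2 * B.card) * L + 4 * (n * N) * S.card := by exact_mod_cast hfin
    have hsLR : (S.card : ℝ) * L ≤ 2 * p := by
      have : S.card * L ≤ 2 * p := by omega
      exact_mod_cast this
    rw [div_le_div_iff₀ hp0 hM0]
    have hBM : (B.card : ℝ) * M ≤ 2 * S.card := by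
      have hDSR : (D.card : ℝ) ≤ S.card := by exact_mod_cast hDS
      calc (B.card : ℝ) * M ≤ 2 / M * D.card * M := by gcongr
        _ = 2 * D.card := by field_simp
        _ ≤ _ := by linarith
    have hL0 : (0:ℝ) ≤ L := by positivity
    have e1 : 2 * (2 * (B.card:ℝ)) * L * M ≤ 16 * p := by
      calc 2 * (2 * (B.card:ℝ)) * L * M = 4 * L * (B.card * M) := by ring
        _ ≤ 4 * L * (2 * S.card) := by gcongr
        _ = 8 * (S.card * L) := by ring
        _ ≤ _ := by linarith
    have e2 : 4 * ((n:ℝ) * N) * S.card * M ≤ p := by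
      calc 4 * ((n:ℝ) * N) * S.card * M ≤ 4 * ((n:ℝ) * N) * (2 * n) * M := by gcongr
        _ = 8 * (n:ℝ) ^ 2 * N * M := by ring
        _ ≤ _ := hbigR
    calc _ ≤ (2 * (2 * (B.card:ℝ)) * L + 4 * (n * N) * S.card) * M :=
          mul_le_mul_of_nonneg_right hfinR hM0.le
      _ ≤ 17 * p := by linarith

lemma lcm_bound (N M : ℕ) : ((Nat.lcmUpto N ^ M : ℕ) : ℝ) ≤ Real.exp (6 * N * M) := by
  have h1 := Chebyshev.psi_le_const_mul_self (x := (N : ℝ)) (by positivity)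
  rw [Chebyshev.psi_eq_log_lcmUpto] at h1
  have h4 : Real.log 4 ≤ 2 := by
    have : (4:ℝ) = 2 ^ 2 := by norm_num
    rw [this, Real.log_pow]
    have := Real.log_two_lt_d9
    push_cast; linarith
  have hN0 : (0:ℝ) ≤ N := by positivity
  have hpos : (0:ℝ) < Nat.lcmUpto N := by exact_mod_cast Nat.lcmUpto_pos N
  have h2 : (Nat.lcmUpto N : ℝ) ≤ Real.exp (6 * N) := by
    rw [← Real.log_le_iff_le_exp hpos]; nlinarith
  push_cast
  calc (Nat.lcmUpto N : ℝ) ^ M ≤ Real.exp (6 * N) ^ M := by gcongr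
    _ = _ := by rw [← Real.exp_nat_mul]; ring_nf

lemma big_bound (p K M : ℕ) (hp : 0 < p) (hK : 1 ≤ K) (h : 40 * (K * M : ℝ) ≤ Real.log p) :
    8 * (Nat.lcmUpto (K + 1) ^ M) ^ 2 * (K + 1) * M ≤ p := by
  have hK' : (1:ℝ) ≤ K := by exact_mod_cast hK
  have hM' : (0:ℝ) ≤ M := by positivity
  have h1 := lcm_bound (K + 1) M
  have h2 : ((Nat.lcmUpto (K+1) ^ M : ℕ) : ℝ) ≤ Real.exp (12 * (K * M)) := by
    refine h1.trans (Real.exp_le_exp.2 ?_)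
    push_cast; nlinarith
  have h3 : 16 * (K * M : ℝ) ≤ Real.exp (16 * (K * M)) := by
    have := Real.add_one_le_exp (16 * (K * M : ℝ)); linarith
  have hp' : (0:ℝ) < p := by exact_mod_cast hp
  have h4 : Real.exp (40 * (K * M)) ≤ p := by
    rw [← Real.le_log_iff_exp_le hp']; exact h
  have : (8 * ((Nat.lcmUpto (K + 1) ^ M : ℕ) : ℝ) ^ 2 * (K + 1) * M) ≤ p := by
    calc _ ≤ 8 * (Real.exp (12 * (K * M))) ^ 2 * (K + K) * M := by gcongr
      _ = Real.exp (12 * (K * M)) ^ 2 * (16 * (K * M)) := by ring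
      _ ≤ Real.exp (12 * (K * M)) ^ 2 * Real.exp (16 * (K * M)) := by gcongr
      _ = Real.exp (40 * (K * M)) := by rw [← Real.exp_nat_mul, ← Real.exp_add]; ring_nf
      _ ≤ p := h4
  exact_mod_cast this

/-- **Green's Problem 90, lower bound (construction).**
If `K p = o(log p)` as `p → ∞` along primes, then there exist sets `A p ⊆ 𝔽_p` of density
`1/2` which are almost invariant under all affine maps `x ↦ a x + b` with
`1 ≤ |a| ≤ K p`, `|b| ≤ K p`, `p ∤ a`. -/
theorem stmt_1 (K : ℕ → ℕ) (hK : ∀ p : ℕ, p.Prime → 1 ≤ K p)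
    (hKo : Tendsto (fun p : ℕ => (K p : ℝ) / Real.log p)
      (atTop ⊓ 𝓟 {p : ℕ | p.Prime}) (nhds 0)) :
    ∃ A : (p : ℕ) → Finset (ZMod p),
      Tendsto (fun p : ℕ => ((A p).card : ℝ) / p)
        (atTop ⊓ 𝓟 {p : ℕ | p.Prime}) (nhds (1 / 2)) ∧
      ∀ δ : ℝ, 0 < δ →
        ∀ᶠ p in (atTop ⊓ 𝓟 {p : ℕ | p.Prime}),
          ∀ a b : ℤ, 1 ≤ |a| → |a| ≤ (K p : ℤ) → |b| ≤ (K p : ℤ) → ¬ ((p : ℤ) ∣ a) →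
            (((A p) ∆ ((A p).image fun x => (a : ZMod p) * x + (b : ZMod p))).card : ℝ) / p ≤ δ := by
  classical
  set F := (atTop ⊓ 𝓟 {p : ℕ | p.Prime} : Filter ℕ) with hF
  have hprime : ∀ᶠ p in F, p.Prime := by
    rw [hF]; exact Filter.mem_inf_of_right (Filter.mem_principal_self _)
  let M : ℕ → ℕ := fun p => ⌊Real.sqrt (Real.log p / K p)⌋₊
  let good : ℕ → Prop := fun p => ∃ A : Finset (ZMod p), |(A.card : ℝ) / p - 1 / 2| ≤ 1 / (M p) ∧
      ∀ a b : ℤ, 1 ≤ |a| → |a| ≤ ((K p + 1 : ℕ) : ℤ) → |b| ≤ ((K p + 1 : ℕ) : ℤ) →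
        ((A ∆ (A.image fun x => (a : ZMod p) * x + (b : ZMod p))).card : ℝ) / p ≤ 17 / (M p)
  have hMlarge : ∀ R : ℕ, 1 ≤ R → ∀ᶠ p in F, R ≤ M p := by
    intro R hR
    have hR0 : (0:ℝ) < R := by exact_mod_cast hR
    have hlt : ∀ᶠ p in F, (K p : ℝ) / Real.log p < 1 / (R : ℝ) ^ 2 :=
      hKo.eventually_lt_const (by positivity)
    filter_upwards [hlt, hprime] with p h hp
    have hKp : (0:ℝ) < K p := by exact_mod_cast hK p hp
    have hlog : 0 < Real.log p := Real.log_pos (by exact_mod_cast hp.one_lt)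
    apply Nat.le_floor
    apply Real.le_sqrt_of_sq_le
    rw [div_lt_div_iff₀ hlog (by positivity)] at h
    rw [le_div_iff₀ hKp]; linarith
  have hgood : ∀ᶠ p in F, good p := by
    have hlt : ∀ᶠ p in F, (K p : ℝ) / Real.log p < 1 / 1600 :=
      hKo.eventually_lt_const (by norm_num)
    filter_upwards [hlt, hprime, hMlarge 1 le_rfl] with p h hp hM1
    have hKp : (0:ℝ) < K p := by exact_mod_cast hK p hp
    have hlog : 0 < Real.log p := Real.log_pos (by exact_mod_cast hp.one_lt)
    have hK1 := hK p hp
    rw [div_lt_div_iff₀ hlog (by norm_num)] at h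
    apply core p (K p + 1) (M p) hp (by omega) hM1
    apply big_bound p (K p) (M p) hp.pos hK1
    have hMs : (M p : ℝ) ≤ Real.sqrt (Real.log p / K p) := Nat.floor_le (Real.sqrt_nonneg _)
    have hsq : Real.sqrt (Real.log p / K p) ^ 2 = Real.log p / K p :=
      Real.sq_sqrt (by positivity)
    set t := Real.sqrt (Real.log p / K p) with ht
    have hlogeq : Real.log p = K p * t ^ 2 := by rw [hsq]; field_simp
    have ht0 : 0 ≤ t := Real.sqrt_nonneg _
    have ht40 : 40 ≤ t := by
      apply Real.le_sqrt_of_sq_le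
      rw [le_div_iff₀ hKp]; linarith
    rw [hlogeq]
    have : 40 * (M p : ℝ) ≤ t ^ 2 := by nlinarith
    nlinarith
  have hA : ∀ p, ∃ A : Finset (ZMod p), good p → (|(A.card : ℝ) / p - 1 / 2| ≤ 1 / (M p) ∧
      ∀ a b : ℤ, 1 ≤ |a| → |a| ≤ ((K p + 1 : ℕ) : ℤ) → |b| ≤ ((K p + 1 : ℕ) : ℤ) →
        ((A ∆ (A.image fun x => (a : ZMod p) * x + (b : ZMod p))).card : ℝ) / p ≤ 17 / (M p)) := by
    intro p
    by_cases h : good p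
    · obtain ⟨A, hA⟩ := h
      exact ⟨A, fun _ => hA⟩
    · exact ⟨∅, fun h' => absurd h' h⟩
  choose A hA using hA
  have hsmall : ∀ δ : ℝ, 0 < δ → ∀ᶠ p in F, 17 / (M p : ℝ) < δ ∧ 1 / (M p : ℝ) < δ := by
    intro δ hδ
    obtain ⟨R, hR⟩ := exists_nat_gt (17 / δ)
    have hR0 : 1 ≤ R := by
      have : (0:ℝ) < R := lt_trans (by positivity) hR
      exact_mod_cast this
    filter_upwards [hMlarge R hR0] with p hp
    have hp' : (R:ℝ) ≤ M p := by exact_mod_cast hp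
    have hM0 : (0:ℝ) < M p := by
      have : (1:ℝ) ≤ R := by exact_mod_cast hR0
      linarith
    have h17 : 17 / (M p : ℝ) < δ := by
      rw [div_lt_iff₀ hδ] at hR
      rw [div_lt_iff₀ hM0]; nlinarith
    refine ⟨h17, lt_of_le_of_lt ?_ h17⟩
    gcongr; norm_num
  refine ⟨A, ?_, ?_⟩
  · rw [Metric.tendsto_nhds]
    intro ε hε
    filter_upwards [hgood, hsmall ε hε] with p hg hs
    rw [Real.dist_eq]
    exact (hA p hg).1.trans_lt hs.2
  · intro δ hδ
    filter_upwards [hgood, hsmall δ hδ] with p hg hs a b h1 h2 h3 _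
    have := (hA p hg).2 a b h1 (by push_cast; linarith) (by push_cast; linarith)
    convert this.trans hs.1.le using 1
end

section
/- For every ε > 0 there exist δ > 0 and p₀ such that the following holds: for every prime p ≥ p₀, every integer K ≥ 1, and every set A ⊆ 𝔽_p satisfying | |A| − p/2 | ≤ δ·p and |A △ (a·A + b)| ≤ δ·p for all integers a, b with 1 ≤ |a| ≤ K, |b| ≤ K and p ∤ a, one has K ≤ ε·log p. -/
open scoped symmDiff

namespace NI

noncomputable def F {p : ℕ} [NeZero p] (S : Finset (ZMod p)) (ξ : ZMod p) : ℂ :=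
  ∑ x ∈ S, ZMod.stdAddChar (x * ξ)

lemma norm_psi {p : ℕ} [NeZero p] (x : ZMod p) : ‖ZMod.stdAddChar x‖ = 1 := by
  rw [ZMod.stdAddChar_apply]; exact Circle.norm_coe _

lemma conj_psi {p : ℕ} [NeZero p] (x : ZMod p) :
    (starRingEnd ℂ) (ZMod.stdAddChar x) = ZMod.stdAddChar (-x) := by
  rw [AddChar.map_neg_eq_inv, Complex.inv_eq_conj (norm_psi x)]

lemma parseval {p : ℕ} [NeZero p] (g : ZMod p → ℂ) :
    ∑ ξ, ‖∑ x, g x * ZMod.stdAddChar (x * ξ)‖ ^ 2 = p * ∑ x, ‖g x‖ ^ 2 := by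
  have h : ((∑ ξ, ‖∑ x, g x * ZMod.stdAddChar (x * ξ)‖ ^ 2 : ℝ) : ℂ)
      = ((p * ∑ x, ‖g x‖ ^ 2 : ℝ) : ℂ) := by
    push_cast
    simp_rw [← Complex.mul_conj', map_sum, map_mul, conj_psi, Finset.sum_mul_sum]
    rw [Finset.sum_comm, Finset.mul_sum]
    refine Finset.sum_congr rfl fun x _ => ?_
    rw [Finset.sum_comm]
    have : ∀ y : ZMod p, ∑ ξ, g x * ZMod.stdAddChar (x * ξ) *
        ((starRingEnd ℂ) (g y) * ZMod.stdAddChar (-(y * ξ)))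
        = if x = y then p * (g x * (starRingEnd ℂ) (g x)) else 0 := by
      intro y
      have h1 := AddChar.sum_mulShift (x - y) (ZMod.isPrimitive_stdAddChar p)
      have h2 : ∀ ξ : ZMod p, g x * ZMod.stdAddChar (x * ξ) *
        ((starRingEnd ℂ) (g y) * ZMod.stdAddChar (-(y * ξ)))
          = (g x * (starRingEnd ℂ) (g y)) * ZMod.stdAddChar (ξ * (x - y)) := by
        intro ξ
        rw [show ξ * (x - y) = x * ξ + -(y * ξ) by ring, AddChar.map_add_eq_mul]; ring
      simp_rw [h2, ← Finset.mul_sum, h1, sub_eq_zero]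
      split_ifs with hxy
      · subst hxy; rw [ZMod.card]; ring
      · simp
    simp_rw [this]
    simp
  exact_mod_cast h

lemma F_eq {p : ℕ} [NeZero p] (S : Finset (ZMod p)) (ξ : ZMod p) :
    F S ξ = ∑ x, (if x ∈ S then 1 else 0) * ZMod.stdAddChar (x * ξ) := by
  simp [F]

lemma parseval_diff {p : ℕ} [NeZero p] (S T : Finset (ZMod p)) :
    ∑ ξ, ‖F S ξ - F T ξ‖ ^ 2 = p * ((S ∆ T).card : ℝ) := by
  simp_rw [F_eq, ← Finset.sum_sub_distrib, ← sub_mul]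
  rw [parseval, Finset.card_eq_sum_ones, ← Finset.sum_filter_add_sum_filter_not Finset.univ (· ∈ S ∆ T)]
  push_cast
  congr 1
  rw [show Finset.univ.filter (· ∈ S ∆ T) = S ∆ T by ext; simp]
  rw [Finset.sum_congr rfl (g := fun _ => (1:ℝ))]
  · simp only [add_eq_left]
    refine Finset.sum_eq_zero fun x hx => ?_
    simp only [Finset.mem_filter, Finset.mem_univ, true_and, Finset.mem_symmDiff] at hx
    by_cases h1 : x ∈ S <;> by_cases h2 : x ∈ T <;> simp_all
  · intro x hx
    simp only [Finset.mem_symmDiff] at hx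
    by_cases h1 : x ∈ S <;> by_cases h2 : x ∈ T <;> simp_all

lemma parseval_self {p : ℕ} [NeZero p] (S : Finset (ZMod p)) :
    ∑ ξ, ‖F S ξ‖ ^ 2 = p * (S.card : ℝ) := by
  have := parseval_diff S ∅
  have h : S ∆ ∅ = S := symmDiff_bot S
  rw [h] at this
  simpa [F] using this

lemma F_zero {p : ℕ} [NeZero p] (S : Finset (ZMod p)) : F S 0 = S.card := by simp [F]

lemma F_trans {p : ℕ} [NeZero p] (S : Finset (ZMod p)) (b ξ : ZMod p) :
    F (S.image fun x => x + b) ξ = ZMod.stdAddChar (b * ξ) * F S ξ := by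
  unfold F
  rw [Finset.sum_image (by intro x _ y _ h; simpa using h), Finset.mul_sum]
  refine Finset.sum_congr rfl fun x _ => ?_
  rw [← AddChar.map_add_eq_mul]; ring_nf

lemma F_dil {p : ℕ} [Fact p.Prime] (S : Finset (ZMod p)) (a ξ : ZMod p) (ha : a ≠ 0) :
    F (S.image fun x => a * x) ξ = F S (a * ξ) := by
  unfold F
  rw [Finset.sum_image (by intro x _ y _ h; simpa [ha] using h)]
  refine Finset.sum_congr rfl fun x _ => ?_
  ring_nf

lemma norm_psi_sub_one {p : ℕ} [NeZero p] (ξ : ZMod p) :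
    4 * |(ξ.valMinAbs : ℝ)| / p ≤ ‖ZMod.stdAddChar ξ - 1‖ := by
  have hp : (0 : ℝ) < p := by exact_mod_cast Nat.pos_of_ne_zero (NeZero.ne p)
  have h1 : (ZMod.stdAddChar ξ : ℂ) =
      Complex.exp (Complex.I * ((2 * Real.pi * ξ.valMinAbs / p : ℝ) : ℂ)) := by
    conv_lhs => rw [← ZMod.coe_valMinAbs ξ]
    rw [ZMod.stdAddChar_coe]; congr 1; push_cast; ring
  rw [h1, Complex.norm_exp_I_mul_ofReal_sub_one, norm_mul, Real.norm_eq_abs, Real.norm_eq_abs]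
  have hv : |(ξ.valMinAbs : ℝ)| ≤ p / 2 := by
    have := ZMod.natAbs_valMinAbs_le ξ
    have h2 : ξ.valMinAbs.natAbs * 2 ≤ p := by omega
    have h3 : ((ξ.valMinAbs.natAbs : ℕ) : ℝ) * 2 ≤ p := by exact_mod_cast h2
    rw [Nat.cast_natAbs, Int.cast_abs] at h3
    linarith
  have h2 : |2 * Real.pi * ξ.valMinAbs / p / 2| = Real.pi * |(ξ.valMinAbs : ℝ)| / p := by
    rw [show 2 * Real.pi * (ξ.valMinAbs : ℝ) / p / 2 = Real.pi * ξ.valMinAbs / p by ring,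
      abs_div, abs_mul, abs_of_pos Real.pi_pos, abs_of_pos hp]
  have h3 := Real.mul_abs_le_abs_sin (x := 2 * Real.pi * ξ.valMinAbs / p / 2) (by
    rw [h2, div_le_div_iff₀ hp (by norm_num)]
    nlinarith [Real.pi_pos])
  rw [h2] at h3
  have h4 : 2 / Real.pi * (Real.pi * |(ξ.valMinAbs : ℝ)| / p) = 2 * |(ξ.valMinAbs : ℝ)| / p := by
    field_simp
  rw [h4] at h3
  rw [abs_of_pos (by norm_num : (0:ℝ) < 2)]
  calc _ = 2 * (2 * |(ξ.valMinAbs : ℝ)| / p) := by ring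
    _ ≤ _ := by gcongr

lemma bad_sum {p : ℕ} [NeZero p] (K : ℕ) (hK : 1 ≤ K) (ξ : ZMod p)
    (h : p ≤ ξ.valMinAbs.natAbs * (2 * K)) :
    (2 * K + 1 : ℝ) ≤ ∑ i ∈ Finset.range (2 * K + 1),
      ‖ZMod.stdAddChar ((((i : ℤ) - (K : ℤ) : ℤ) : ZMod p) * ξ) - 1‖ ^ 2 := by
  have hp : (0 : ℝ) < p := by exact_mod_cast Nat.pos_of_ne_zero (NeZero.ne p)
  have hK' : (0 : ℝ) < K := by exact_mod_cast hK
  set z : ℂ := ZMod.stdAddChar ξ with hz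
  have hz1 : 2 / K ≤ ‖z - 1‖ := by
    refine le_trans ?_ (norm_psi_sub_one ξ)
    have h3 : (p : ℝ) ≤ ((ξ.valMinAbs.natAbs : ℕ) : ℝ) * (2 * K) := by exact_mod_cast h
    rw [Nat.cast_natAbs, Int.cast_abs] at h3
    rw [div_le_div_iff₀ hK' hp]; nlinarith
  have hg : ‖∑ i ∈ Finset.range (2 * K + 1), z ^ i‖ ≤ K := by
    have h1 := geom_sum_mul z (2 * K + 1)
    have h2 : ‖∑ i ∈ Finset.range (2 * K + 1), z ^ i‖ * ‖z - 1‖ ≤ 2 := by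
      rw [← norm_mul, h1]
      refine (norm_sub_le _ _).trans ?_
      rw [norm_pow, hz, norm_psi]; norm_num
    have h3 : ‖∑ i ∈ Finset.range (2 * K + 1), z ^ i‖ * (2 / K) ≤ 2 :=
      le_trans (by gcongr) h2
    rw [← mul_div_assoc, div_le_iff₀ hK'] at h3
    linarith
  set c : ℂ := ZMod.stdAddChar (-((K : ZMod p) * ξ)) with hc
  have hterm : ∀ i : ℕ, ‖ZMod.stdAddChar ((((i : ℤ) - (K : ℤ) : ℤ) : ZMod p) * ξ) - 1‖ ^ 2
      = 2 - 2 * (z ^ i * c).re := by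
    intro i
    have h1 : (ZMod.stdAddChar ((((i : ℤ) - (K : ℤ) : ℤ) : ZMod p) * ξ) : ℂ) = z ^ i * c := by
      rw [hz, hc, ← AddChar.map_nsmul_eq_pow, ← AddChar.map_add_eq_mul]
      congr 1; push_cast; rw [nsmul_eq_mul]; ring
    have h2 : ‖z ^ i * c‖ ^ 2 = 1 := by rw [← h1, norm_psi]; norm_num
    rw [h1, ← Complex.normSq_eq_norm_sq, Complex.normSq_apply]
    rw [← Complex.normSq_eq_norm_sq, Complex.normSq_apply] at h2
    simp only [Complex.sub_re, Complex.sub_im, Complex.one_re, Complex.one_im]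
    linarith
  simp_rw [hterm]
  rw [Finset.sum_sub_distrib, ← Finset.mul_sum, ← Complex.re_sum, ← Finset.sum_mul]
  have h5 : ((∑ i ∈ Finset.range (2 * K + 1), z ^ i) * c).re ≤ K := by
    refine (Complex.re_le_norm _).trans ?_
    rw [norm_mul, hc, norm_psi, mul_one]; exact hg
  rw [Finset.sum_const, Finset.card_range, nsmul_eq_mul]
  push_cast
  linarith

lemma nt (J K n : ℕ) (hn : n ≠ 0) :
    ∑ q ∈ (Nat.primesLE K).filter (fun q => q ^ J ∣ n), (J : ℝ) * Real.log q ≤ Real.log n := by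
  have h : ∏ q ∈ (Nat.primesLE K).filter (fun q => q ^ J ∣ n), q ^ J ∣ n := by
    refine Finset.prod_dvd_of_isRelPrime ?_ (fun i hi => (Finset.mem_filter.1 hi).2)
    · intro i hi j hj hij
      have h1 := (Nat.mem_primesLE.1 (Finset.mem_filter.1 hi).1).2
      have h2 := (Nat.mem_primesLE.1 (Finset.mem_filter.1 hj).1).2
      exact Nat.coprime_iff_isRelPrime.1 (Nat.Coprime.pow _ _ ((Nat.coprime_primes h1 h2).2 hij))
  have h2 := Nat.le_of_dvd (Nat.pos_of_ne_zero hn) h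
  have h0 : ∀ q ∈ (Nat.primesLE K).filter (fun q => q ^ J ∣ n), ((q : ℝ) ^ J) ≠ 0 := by
    intro q hq
    have h1 := (Nat.mem_primesLE.1 (Finset.mem_filter.1 hq).1).2
    have := h1.pos
    positivity
  simp_rw [← Real.log_pow]
  rw [← Real.log_prod h0]
  have hpos : (0:ℝ) < ∏ q ∈ (Nat.primesLE K).filter (fun q => q ^ J ∣ n), (q : ℝ) ^ J := by
    refine Finset.prod_pos fun q hq => ?_
    have h1 := (Nat.mem_primesLE.1 (Finset.mem_filter.1 hq).1).2
    have := h1.pos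
    positivity
  exact Real.log_le_log hpos (by exact_mod_cast h2)


lemma theta_lower : ∃ N : ℕ, ∀ n : ℕ, N ≤ n → (n : ℝ) / 4 ≤ ∑ q ∈ Nat.primesLE n, Real.log q := by
  obtain ⟨C, hC⟩ := Chebyshev.psi_sub_theta_le_mul_sqrt
  obtain ⟨N, hN⟩ := exists_nat_ge ((max 1 (4 * (|C| + 4))) ^ 2)
  refine ⟨N, fun n hn => ?_⟩
  rw [← Chebyshev.theta_eq_sum_primesLE_log]
  have h1 := hC n
  have h2 := Chebyshev.psi_ge n
  set s := Real.sqrt n with hs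
  have hss : s ^ 2 = n := Real.sq_sqrt (Nat.cast_nonneg n)
  have hs0 : 0 ≤ s := Real.sqrt_nonneg _
  have hsm : max 1 (4 * (|C| + 4)) ≤ s := by
    rw [hs]; apply Real.le_sqrt_of_sq_le
    exact hN.trans (by exact_mod_cast hn)
  have hs1 := (le_max_left _ _).trans hsm
  have hs2 := (le_max_right _ _).trans hsm
  have h3 : Real.log (n + 1) ≤ 2 * s := by
    have h4 : Real.log ((s + 1) ^ 2) ≤ 2 * s := by
      rw [Real.log_pow]
      have := Real.log_le_sub_one_of_pos (x := s + 1) (by positivity)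
      push_cast
      linarith
    refine le_trans (Real.log_le_log (by positivity) ?_) h4
    nlinarith
  have h5 := Real.log_two_gt_d9
  have h6 : C * s ≤ |C| * s := by gcongr; exact le_abs_self C
  have h7 : (n : ℝ) * 0.69 ≤ n * Real.log 2 := by gcongr; linarith
  nlinarith

lemma bad_mass {p : ℕ} [Fact p.Prime] (K : ℕ) (hK : 1 ≤ K) (A : Finset (ZMod p)) (d : ℝ)
    (h : ∀ b : ℤ, |b| ≤ K → ((A ∆ (A.image fun x => x + (b : ZMod p))).card : ℝ) ≤ d * p) :
    ∑ ξ with p ≤ ξ.valMinAbs.natAbs * (2 * K), ‖F A ξ‖ ^ 2 ≤ d * p ^ 2 := by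
  have h1 : ∀ i ∈ Finset.range (2 * K + 1), ∑ ξ, ‖F A ξ‖ ^ 2 *
      ‖ZMod.stdAddChar ((((i : ℤ) - (K : ℤ) : ℤ) : ZMod p) * ξ) - 1‖ ^ 2 ≤ d * p ^ 2 := by
    intro i hi
    have hi := Finset.mem_range.1 hi
    have h2 := h ((i : ℤ) - K) (by rw [abs_le]; omega)
    have h3 := parseval_diff A (A.image fun x => x + (((i : ℤ) - (K : ℤ) : ℤ) : ZMod p))
    simp_rw [F_trans] at h3
    have h4 : ∑ ξ, ‖F A ξ‖ ^ 2 *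
      ‖ZMod.stdAddChar ((((i : ℤ) - (K : ℤ) : ℤ) : ZMod p) * ξ) - 1‖ ^ 2 = 
      p * ((A ∆ (A.image fun x => x + (((i : ℤ) - (K : ℤ) : ℤ) : ZMod p))).card : ℝ) := by
      rw [← h3]
      refine Finset.sum_congr rfl fun ξ _ => ?_
      rw [← mul_pow, ← norm_mul, mul_sub, mul_one, norm_sub_rev, mul_comm]
    rw [h4]
    calc _ ≤ (p : ℝ) * (d * p) := by gcongr
      _ = _ := by ring
  have h2 := Finset.sum_le_sum h1
  rw [Finset.sum_comm, Finset.sum_const, Finset.card_range, nsmul_eq_mul] at h2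
  simp_rw [← Finset.mul_sum] at h2
  have h3 : ∑ ξ with p ≤ ξ.valMinAbs.natAbs * (2 * K), ‖F A ξ‖ ^ 2 * (2 * K + 1 : ℝ) ≤ 
      ((2 * K + 1 : ℕ) : ℝ) * (d * p ^ 2) := by
    refine le_trans ?_ h2
    refine le_trans ?_ (Finset.sum_le_sum_of_subset_of_nonneg (Finset.filter_subset
      (fun ξ : ZMod p => p ≤ ξ.valMinAbs.natAbs * (2 * K)) Finset.univ)
      (fun ξ _ _ => by positivity))
    refine Finset.sum_le_sum fun ξ hξ => ?_
    gcongr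
    exact bad_sum K hK ξ (Finset.mem_filter.1 hξ).2
  rw [← Finset.sum_mul, mul_comm] at h3
  push_cast at h3
  exact le_of_mul_le_mul_left h3 (by positivity)

lemma dil_mass {p : ℕ} [Fact p.Prime] (a : ZMod p) (ha : a ≠ 0) (A : Finset (ZMod p)) (t : ℝ)
    (ht : 0 < t)
    (h : ((A ∆ (A.image fun x => a * x)).card : ℝ) ≤ t ^ 2 * p) :
    ∑ ξ, |‖F A (a * ξ)‖ ^ 2 - ‖F A ξ‖ ^ 2| ≤ 5 / 2 * t * p ^ 2 := by
  have h3 := parseval_diff A (A.image fun x => a * x)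
  simp_rw [F_dil _ _ _ ha] at h3
  have h4 : ∀ ξ, |‖F A (a * ξ)‖ ^ 2 - ‖F A ξ‖ ^ 2| ≤
      ‖F A ξ - F A (a * ξ)‖ ^ 2 / (2 * t) + t * (‖F A (a * ξ)‖ ^ 2 + ‖F A ξ‖ ^ 2) := by
    intro ξ
    set u := ‖F A (a * ξ)‖
    set v := ‖F A ξ‖
    set d := ‖F A ξ - F A (a * ξ)‖
    have hd : |u - v| ≤ d := by
      rw [abs_sub_comm]; exact abs_norm_sub_norm_le _ _
    have hu : 0 ≤ u := norm_nonneg _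
    have hv : 0 ≤ v := norm_nonneg _
    have h5 : |u ^ 2 - v ^ 2| ≤ d * (u + v) := by
      rw [sq_sub_sq, abs_mul, abs_of_nonneg (by positivity : 0 ≤ u + v), mul_comm]
      gcongr
    refine h5.trans ?_
    have h6 : d * (u + v) ≤ d ^ 2 / (2 * t) + t * (u + v) ^ 2 / 2 := by
      have : d ^ 2 / (2 * t) + t * (u + v) ^ 2 / 2 - d * (u + v)
        = (d - t * (u + v)) ^ 2 / (2 * t) := by field_simp; ring
      have h7 : 0 ≤ (d - t * (u + v)) ^ 2 / (2 * t) := by positivity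
      linarith
    have h8 : t * (u + v) ^ 2 / 2 ≤ t * (u ^ 2 + v ^ 2) := by
      nlinarith [mul_nonneg ht.le (sq_nonneg (u - v))]
    linarith
  refine (Finset.sum_le_sum fun ξ _ => h4 ξ).trans ?_
  rw [Finset.sum_add_distrib, ← Finset.sum_div, ← Finset.mul_sum, Finset.sum_add_distrib, h3]
  have h5 : ∑ ξ, ‖F A (a * ξ)‖ ^ 2 = ∑ ξ, ‖F A ξ‖ ^ 2 :=
    Equiv.sum_comp (Equiv.mulLeft₀ a ha) (fun ξ => ‖F A ξ‖ ^ 2)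
  rw [h5, parseval_self]
  have h6 : (A.card : ℝ) ≤ p := by
    have := Finset.card_le_univ A
    rw [ZMod.card] at this
    exact_mod_cast this
  have h7 : (p : ℝ) * ((A ∆ (A.image fun x => a * x)).card : ℝ) / (2 * t) ≤ t / 2 * p ^ 2 := by
    rw [div_le_iff₀ (by positivity)]
    calc _ ≤ (p : ℝ) * (t ^ 2 * p) := by gcongr
      _ = _ := by ring
  have h8 : t * ((p : ℝ) * A.card + p * A.card) ≤ t * ((p : ℝ) * p + p * p) := by gcongr
  linarith

lemma val_mul {p : ℕ} [Fact p.Prime] (K q : ℕ) (hq : q ≤ K) (η : ZMod p)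
    (h : η.valMinAbs.natAbs * (2 * K) < p) :
    ((q : ZMod p) * η).valMinAbs = q * η.valMinAbs := by
  rw [ZMod.valMinAbs_spec]
  refine ⟨by push_cast [ZMod.coe_valMinAbs]; rfl, ?_⟩
  have h1 : η.valMinAbs.natAbs * (2 * q) < p := lt_of_le_of_lt (by gcongr) h
  have h2 : |η.valMinAbs * (2 * q)| < p := by
    rw [abs_mul, Int.abs_eq_natAbs η.valMinAbs, abs_of_nonneg (by positivity)]
    exact_mod_cast h1
  rw [abs_lt] at h2
  constructor <;> linarith

lemma rec_mass {p : ℕ} [Fact p.Prime] (K q : ℕ) (hq : q ≤ K) (hq1 : q.Prime) (hKp : K < p)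
    (w : ZMod p → ℝ) (hw : ∀ ξ, 0 ≤ w ξ) (B D : ℝ)
    (hB : ∑ ξ with p ≤ ξ.valMinAbs.natAbs * (2 * K), w ξ ≤ B)
    (hD : ∑ ξ, |w (q * ξ) - w ξ| ≤ D) (j : ℕ) :
    ∑ ξ with (ξ ≠ 0 ∧ ξ.valMinAbs.natAbs * (2 * K) < p) ∧ ¬ (q ^ j ∣ ξ.valMinAbs.natAbs), w ξ
      ≤ j * (B + D) := by
  have hq0 : (q : ZMod p) ≠ 0 := by
    rw [Ne, ZMod.natCast_eq_zero_iff]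
    exact Nat.not_dvd_of_pos_of_lt hq1.pos (by omega)
  induction j with
  | zero => simp
  | succ j ih =>
    have h1 : ∑ ξ with (ξ ≠ 0 ∧ ξ.valMinAbs.natAbs * (2 * K) < p) ∧
          ¬ (q ^ (j + 1) ∣ ξ.valMinAbs.natAbs), w ξ
        = ∑ η : ZMod p with (((q : ZMod p) * η ≠ 0 ∧ (q * η : ZMod p).valMinAbs.natAbs * (2 * K) < p) ∧
          ¬ (q ^ (j + 1) ∣ (q * η : ZMod p).valMinAbs.natAbs)), w (q * η) := by
      rw [Finset.sum_filter, Finset.sum_filter]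
      exact (Equiv.sum_comp (Equiv.mulLeft₀ (q : ZMod p) hq0) (fun ξ =>
        if (ξ ≠ 0 ∧ ξ.valMinAbs.natAbs * (2 * K) < p) ∧
          ¬ (q ^ (j + 1) ∣ ξ.valMinAbs.natAbs) then w ξ else 0)).symm
    rw [h1]
    set E' := Finset.univ.filter (fun η : ZMod p =>
      ((q * η ≠ 0 ∧ (q * η : ZMod p).valMinAbs.natAbs * (2 * K) < p) ∧
          ¬ (q ^ (j + 1) ∣ (q * η : ZMod p).valMinAbs.natAbs))) with hE'
    have h2 : ∑ η ∈ E', w (q * η) ≤ ∑ η ∈ E', w η + D := by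
      have h3 : ∑ η ∈ E', |w (q * η) - w η| ≤ D :=
        (Finset.sum_le_sum_of_subset_of_nonneg (Finset.subset_univ _)
          (fun _ _ _ => abs_nonneg _)).trans hD
      refine le_trans ?_ (add_le_add_right h3 _)
      rw [← Finset.sum_add_distrib]
      refine Finset.sum_le_sum fun η _ => ?_
      linarith [le_abs_self (w (q * η) - w η)]
    have h4 : E' ⊆ (Finset.univ.filter (fun ξ : ZMod p =>
        (ξ ≠ 0 ∧ ξ.valMinAbs.natAbs * (2 * K) < p) ∧ ¬ (q ^ j ∣ ξ.valMinAbs.natAbs))) ∪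
        (Finset.univ.filter (fun ξ : ZMod p => p ≤ ξ.valMinAbs.natAbs * (2 * K))) := by
      intro η hη
      simp only [hE', Finset.mem_filter, Finset.mem_univ, true_and, Finset.mem_union] at hη ⊢
      by_cases hb : p ≤ η.valMinAbs.natAbs * (2 * K)
      · exact Or.inr hb
      · left
        push Not at hb
        have hv := val_mul K q hq η hb
        refine ⟨⟨fun h0 => hη.1.1 (by rw [h0, mul_zero]), hb⟩, fun hd => hη.2 ?_⟩
        rw [hv, Int.natAbs_mul, Int.natAbs_natCast, pow_succ']
        exact Nat.mul_dvd_mul_left q hd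
    have h5 := Finset.sum_le_sum_of_subset_of_nonneg h4 (fun i _ _ => hw i)
    have h6 := Finset.sum_union_inter (s₁ := (Finset.univ.filter (fun ξ : ZMod p =>
        (ξ ≠ 0 ∧ ξ.valMinAbs.natAbs * (2 * K) < p) ∧ ¬ (q ^ j ∣ ξ.valMinAbs.natAbs))))
        (s₂ := (Finset.univ.filter (fun ξ : ZMod p => p ≤ ξ.valMinAbs.natAbs * (2 * K)))) (f := w)
    have h7 := Finset.sum_nonneg (s := (Finset.univ.filter (fun ξ : ZMod p =>
        (ξ ≠ 0 ∧ ξ.valMinAbs.natAbs * (2 * K) < p) ∧ ¬ (q ^ j ∣ ξ.valMinAbs.natAbs))) ∩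
        (Finset.univ.filter (fun ξ : ZMod p => p ≤ ξ.valMinAbs.natAbs * (2 * K))))
        (fun i _ => hw i)
    push_cast
    linarith

lemma core {p : ℕ} [Fact p.Prime] (K J : ℕ) (hK : 1 ≤ K) (hKp : K < p) (hJ : 1 ≤ J) (t : ℝ)
    (ht : 0 < t) (htJ : 56 * J * t ≤ 1) (A : Finset (ZMod p))
    (hA : (p : ℝ) ^ 2 / 8 ≤ p * A.card - (A.card : ℝ) ^ 2)
    (htr : ∀ b : ℤ, |b| ≤ K → ((A ∆ (A.image fun x => x + (b : ZMod p))).card : ℝ) ≤ t ^ 2 * p)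
    (hdi : ∀ q : ℕ, 1 ≤ q → q ≤ K →
      ((A ∆ (A.image fun x => (q : ZMod p) * x)).card : ℝ) ≤ t ^ 2 * p) :
    J * ∑ q ∈ Nat.primesLE K, Real.log q ≤ 32 * Real.log p := by
  have hp : (0 : ℝ) < p := by exact_mod_cast (Fact.out : p.Prime).pos
  have hJ' : (1 : ℝ) ≤ J := by exact_mod_cast hJ
  have ht1 : t ≤ 1 / 56 := by nlinarith
  set w : ZMod p → ℝ := fun ξ => ‖F A ξ‖ ^ 2 with hwdef
  have hw : ∀ ξ, 0 ≤ w ξ := fun ξ => by positivity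
  have hB : ∑ ξ with p ≤ ξ.valMinAbs.natAbs * (2 * K), w ξ ≤ t ^ 2 * p ^ 2 :=
    bad_mass K hK A _ htr
  set G := Finset.univ.filter (fun ξ : ZMod p => ξ ≠ 0 ∧ ξ.valMinAbs.natAbs * (2 * K) < p) with hG
  have htot : ∑ ξ, w ξ = p * A.card := parseval_self A
  have hw0 : w 0 = (A.card : ℝ) ^ 2 := by simp [hwdef, F_zero]
  have hcard : (A.card : ℝ) ≤ p := by
    have := Finset.card_le_univ A
    rw [ZMod.card] at this
    exact_mod_cast this
  have hGmass : (p : ℝ) ^ 2 / 8 - t ^ 2 * p ^ 2 ≤ ∑ ξ ∈ G, w ξ := by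
    have h1 := Finset.sum_filter_add_sum_filter_not Finset.univ
      (fun ξ : ZMod p => p ≤ ξ.valMinAbs.natAbs * (2 * K)) w
    have h2 : Finset.univ.filter (fun ξ : ZMod p => ¬ p ≤ ξ.valMinAbs.natAbs * (2 * K))
        = insert 0 G := by
      ext ξ
      simp only [hG, Finset.mem_filter, Finset.mem_univ, true_and, Finset.mem_insert, not_le]
      by_cases h0 : ξ = 0
      · subst h0; simpa using (Fact.out : p.Prime).pos
      · simp [h0]
    rw [h2, Finset.sum_insert (by simp [hG]), hw0, htot] at h1
    linarith
  have hq : ∀ q ∈ Nat.primesLE K,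
      (p : ℝ) ^ 2 / 32 ≤ ∑ ξ ∈ G with q ^ J ∣ ξ.valMinAbs.natAbs, w ξ := by
    intro q hq
    obtain ⟨hqK, hqp⟩ := Nat.mem_primesLE.1 hq
    have hq0 : (q : ZMod p) ≠ 0 := by
      rw [Ne, ZMod.natCast_eq_zero_iff]
      exact Nat.not_dvd_of_pos_of_lt hqp.pos (by omega)
    have hD := dil_mass (q : ZMod p) hq0 A t ht (hdi q hqp.pos hqK)
    have h1 := rec_mass K q hqK hqp hKp w hw _ _ hB hD J
    have h2 := Finset.sum_filter_add_sum_filter_not G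
      (fun ξ : ZMod p => q ^ J ∣ ξ.valMinAbs.natAbs) w
    rw [← Finset.filter_filter, ← hG] at h1
    have h3 : (J : ℝ) * (t ^ 2 * p ^ 2 + 5 / 2 * t * p ^ 2) ≤ p ^ 2 / 16 := by
      have h4 : t ^ 2 ≤ t := by nlinarith
      have h5 : (J : ℝ) * (t ^ 2 + 5 / 2 * t) ≤ 1 / 16 := by nlinarith
      calc _ = (J : ℝ) * (t ^ 2 + 5 / 2 * t) * p ^ 2 := by ring
        _ ≤ 1 / 16 * p ^ 2 := by gcongr
        _ = _ := by ring
    have h6 : t ^ 2 * (p : ℝ) ^ 2 ≤ 1 / 32 * p ^ 2 := by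
      gcongr; nlinarith
    linarith
  have hlog0 : ∀ q : ℕ, 0 ≤ (J : ℝ) * Real.log q := fun q => by positivity
  have h1 : ∑ q ∈ Nat.primesLE K, (J : ℝ) * Real.log q * ((p : ℝ) ^ 2 / 32)
      ≤ ∑ ξ ∈ G, w ξ * Real.log p := by
    calc _ ≤ ∑ q ∈ Nat.primesLE K, (J : ℝ) * Real.log q *
          ∑ ξ ∈ G with q ^ J ∣ ξ.valMinAbs.natAbs, w ξ := by
          refine Finset.sum_le_sum fun q h => ?_
          exact mul_le_mul_of_nonneg_left (hq q h) (hlog0 q)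
      _ = ∑ ξ ∈ G, w ξ * ∑ q ∈ (Nat.primesLE K).filter
            (fun q => q ^ J ∣ ξ.valMinAbs.natAbs), (J : ℝ) * Real.log q := by
          simp_rw [Finset.mul_sum, Finset.sum_filter]
          rw [Finset.sum_comm]
          refine Finset.sum_congr rfl fun ξ _ => Finset.sum_congr rfl fun q _ => ?_
          split_ifs <;> ring
      _ ≤ _ := by
          refine Finset.sum_le_sum fun ξ hξ => ?_
          have hξ := (Finset.mem_filter.1 hξ).2
          have hn : ξ.valMinAbs.natAbs ≠ 0 := by
            rw [Ne, Int.natAbs_eq_zero, ZMod.valMinAbs_eq_zero]; exact hξ.1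
          refine mul_le_mul_of_nonneg_left ((nt J K _ hn).trans ?_) (hw ξ)
          refine Real.log_le_log (by exact_mod_cast Nat.pos_of_ne_zero hn) ?_
          have := ZMod.natAbs_valMinAbs_le ξ
          exact_mod_cast this.trans (Nat.div_le_self p 2)
  have h2 : ∑ ξ ∈ G, w ξ ≤ (p : ℝ) ^ 2 := by
    refine (Finset.sum_le_sum_of_subset_of_nonneg (Finset.subset_univ _)
      (fun i _ _ => hw i)).trans ?_
    rw [htot, sq]; gcongr
  have hlp : 0 ≤ Real.log p := by positivity
  rw [← Finset.sum_mul, ← Finset.mul_sum, ← Finset.sum_mul] at h1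
  have h3 : (∑ ξ ∈ G, w ξ) * Real.log p ≤ (p : ℝ) ^ 2 * Real.log p := by gcongr
  have h4 : (0 : ℝ) < p ^ 2 := by positivity
  have h5 := h1.trans h3
  refine le_of_mul_le_mul_left ?_ h4
  linarith

end NI

/-- Quantitative form of the upper bound: for every `ε > 0` there are `δ > 0` and `p₀`
such that for all primes `p ≥ p₀`, all `K ≥ 1`, and all `A ⊆ 𝔽_p` with
`||A| − p/2| ≤ δ p` and `|A ∆ (aA + b)| ≤ δ p` for all admissible `a, b`,
one has `K ≤ ε log p`. -/
theorem stmt_2 :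
    ∀ ε : ℝ, 0 < ε → ∃ δ : ℝ, 0 < δ ∧ ∃ p₀ : ℕ, ∀ p : ℕ, p.Prime → p₀ ≤ p →
      ∀ K : ℕ, 1 ≤ K → ∀ A : Finset (ZMod p),
        |(A.card : ℝ) - (p : ℝ) / 2| ≤ δ * p →
        (∀ a b : ℤ, 1 ≤ |a| → |a| ≤ (K : ℤ) → |b| ≤ (K : ℤ) → ¬ ((p : ℤ) ∣ a) →
          ((A ∆ (A.image fun x => (a : ZMod p) * x + (b : ZMod p))).card : ℝ) ≤ δ * p) →
        (K : ℝ) ≤ ε * Real.log p := by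
  intro ε hε
  obtain ⟨N, hN⟩ := NI.theta_lower
  -- J with 128 / J < ε
  obtain ⟨J, hJ⟩ := exists_nat_gt (max 1 (128 / ε))
  have hJ1 := (le_max_left _ _).trans_lt hJ
  have hJ2 := (le_max_right _ _).trans_lt hJ
  have hJ0 : (0 : ℝ) < J := by linarith
  have hev : ∀ᶠ n : ℕ in Filter.atTop, (N : ℝ) ≤ ε * Real.log n ∧ ε * Real.log n + 1 < n := by
    have h1 : Filter.Tendsto (fun n : ℕ => ε * Real.log n) Filter.atTop Filter.atTop :=
      (Real.tendsto_log_atTop.comp tendsto_natCast_atTop_atTop).const_mul_atTop hε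
    have h2 := (Real.isLittleO_log_id_atTop.comp_tendsto
      (tendsto_natCast_atTop_atTop (R := ℝ))).bound (c := 1 / (2 * ε)) (by positivity)
    filter_upwards [h1.eventually_ge_atTop (N : ℝ), h2, Filter.eventually_gt_atTop 2]
      with n hn1 hn2 hn3
    refine ⟨hn1, ?_⟩
    have hn3' : (2 : ℝ) < n := by exact_mod_cast hn3
    simp only [Function.comp, id, Real.norm_eq_abs, Nat.abs_cast] at hn2
    have h4 := (le_abs_self _).trans hn2
    have h5 : ε * Real.log n ≤ ε * (1 / (2 * ε) * n) := by gcongr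
    have h6 : ε * (1 / (2 * ε) * n) = n / 2 := by field_simp
    linarith
  obtain ⟨p₀, hp₀⟩ := Filter.eventually_atTop.1 hev
  set t : ℝ := 1 / (56 * J) with ht
  have ht0 : 0 < t := by positivity
  have htJ : 56 * J * t = 1 := by rw [ht]; field_simp
  have ht1 : t ≤ 1 / 56 := by nlinarith
  refine ⟨t ^ 2, by positivity, p₀, ?_⟩
  intro p hp hpp K hK A hA h
  by_contra hcon
  push Not at hcon
  have : Fact p.Prime := ⟨hp⟩
  obtain ⟨hp1, hp2⟩ := hp₀ p hpp
  have hpos : (0 : ℝ) < p := by exact_mod_cast hp.pos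
  have hlog : 0 ≤ ε * Real.log p := by positivity
  set L := ⌊ε * Real.log p⌋₊ + 1 with hL
  have hL1 : ε * Real.log p < L := by rw [hL]; push_cast; exact Nat.lt_floor_add_one _
  have hLK : L ≤ K := by
    rw [hL, Nat.succ_le_iff, Nat.floor_lt hlog]; exact hcon
  have hLp : L < p := by
    have : (L : ℝ) < p := by
      rw [hL]; push_cast
      linarith [Nat.floor_le hlog]
    exact_mod_cast this
  have hLN : N ≤ L := by
    have : (N : ℝ) ≤ L := by linarith
    exact_mod_cast this
  have hA' : (p : ℝ) ^ 2 / 8 ≤ p * A.card - (A.card : ℝ) ^ 2 := by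
    have h1 : |(A.card : ℝ) - (p : ℝ) / 2| ≤ 1 / 4 * p := hA.trans (by gcongr; nlinarith)
    have h2 := sq_le_sq' (by linarith [abs_le.1 h1 |>.1]) (abs_le.1 h1).2
    nlinarith
  have hfin := NI.core L J (by omega) hLp (by exact_mod_cast hJ1.le) t ht0 htJ.le A hA'
    (by
      intro b hb
      have := h 1 b (by norm_num) (by simpa using hK) (by omega) (by
        intro hd
        have := Int.le_of_dvd one_pos hd
        have := hp.two_le
        omega)
      simpa using this)
    (by
      intro q hq hqL
      have := h q 0 (by rw [Nat.abs_cast]; exact_mod_cast hq)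
        (by rw [Nat.abs_cast]; exact_mod_cast hqL.trans hLK) (by simp) (by
        intro hd
        have := Nat.le_of_dvd hq (Int.natCast_dvd_natCast.1 hd)
        omega)
      simpa using this)
  have h1 := hN L hLN
  have h2 : (J : ℝ) * (L / 4) ≤ 32 * Real.log p := (by gcongr : _ ≤ _).trans hfin
  have h3 : 128 < J * ε := by rwa [div_lt_iff₀ hε] at hJ2
  have hlogp : 0 ≤ Real.log p := by positivity
  have h4 : (J : ℝ) * (ε * Real.log p) < J * L := by gcongr
  nlinarith
end

section
/- Let p be a prime, let q, N be integers with q ≥ 2, N ≥ 1 and q·N ≤ (p−1)/2, and let μ : 𝔽_p → ℝ≥0 satisfy μ(0) = 0 and ∑_{r ∈ 𝔽_p} μ(r) = 1. Let I := {r ∈ 𝔽_p : 1 ≤ |r| ≤ N}, and suppose μ(I) ≥ 1 − δ with 0 ≤ δ < 1, and ∑_{r ∈ 𝔽_p, r ≠ 0} |μ(r) − μ(q·r)| ≤ δ′ (with q·r computed in 𝔽_p). Define λ(n) := (μ(n̄) + μ(−n̄)) / μ(I) for 1 ≤ n ≤ N, where n̄ is the image of n in 𝔽_p. Then ∑_{1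 ≤ n ≤ N, q·n ≤ N} |λ(n) − λ(q·n)| + ∑_{1 ≤ n ≤ N, q·n > N} λ(n) ≤ (δ + 2δ′)/(1 − δ). -/
/-- The set `I = {r ∈ 𝔽_p : 1 ≤ |r| ≤ N}`, where `|r|` is the absolute value of the
representative of `r` in `[−(p−1)/2, (p−1)/2]`. -/
def Iset (p N : ℕ) [NeZero p] : Finset (ZMod p) :=
  Finset.univ.filter fun r : ZMod p => 1 ≤ r.valMinAbs.natAbs ∧ r.valMinAbs.natAbs ≤ N

/-- The measure `λ(n) = (μ(n̄) + μ(−n̄)) / μ(I)` on `{1, …, N}`. -/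
noncomputable def lamOf (p N : ℕ) [NeZero p] (μ : ZMod p → ℝ) (n : ℕ) : ℝ :=
  (μ ((n : ZMod p)) + μ (-(n : ZMod p))) / ∑ r ∈ Iset p N, μ r

theorem fold_sum_le (p : ℕ) [Fact p.Prime] (F : ZMod p → ℝ) (hF : ∀ r, 0 ≤ F r)
    (A : Finset ℕ) (hA : ∀ a ∈ A, 1 ≤ a ∧ 2 * a ≤ p - 1) (S : Finset (ZMod p))
    (hS : ∀ a ∈ A, (a : ZMod p) ∈ S ∧ -(a : ZMod p) ∈ S) :
    ∑ a ∈ A, (F (a : ZMod p) + F (-(a : ZMod p))) ≤ ∑ r ∈ S, F r := by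
  classical
  have hp : 2 ≤ p := (Fact.out : p.Prime).two_le
  have inj : ∀ a ∈ A, ∀ b ∈ A, (a : ZMod p) = (b : ZMod p) → a = b := by
    intro a ha b hb h
    have h1 := hA a ha
    have h2 := hA b hb
    rw [ZMod.natCast_eq_natCast_iff'] at h
    rwa [Nat.mod_eq_of_lt (by omega), Nat.mod_eq_of_lt (by omega)] at h
  have i1 : Set.InjOn (fun a : ℕ => (a : ZMod p)) (A : Set ℕ) :=
    fun a ha b hb h => inj a ha b hb h
  have i2 : Set.InjOn (fun a : ℕ => -(a : ZMod p)) (A : Set ℕ) :=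
    fun a ha b hb h => inj a ha b hb (neg_injective h)
  rw [Finset.sum_add_distrib, ← Finset.sum_image (f := F) i1, ← Finset.sum_image (f := F) i2,
    ← Finset.sum_union]
  · apply Finset.sum_le_sum_of_subset_of_nonneg
    · intro r hr
      rw [Finset.mem_union, Finset.mem_image, Finset.mem_image] at hr
      rcases hr with ⟨a, ha, rfl⟩ | ⟨a, ha, rfl⟩
      · exact (hS a ha).1
      · exact (hS a ha).2
    · intro r _ _
      exact hF r
  · rw [Finset.disjoint_left]
    intro r hr hr'
    rw [Finset.mem_image] at hr hr'
    obtain ⟨a, ha, rfl⟩ := hr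
    obtain ⟨b, hb, h⟩ := hr'
    have h0 : ((a + b : ℕ) : ZMod p) = 0 := by
      push_cast
      rw [← h]; simp
    rw [ZMod.natCast_eq_zero_iff] at h0
    have h1 := hA a ha
    have h2 := hA b hb
    have := Nat.le_of_dvd (by omega) h0
    omega

/-- Transfer of approximate dilation invariance of `μ` on `𝔽_p` to approximate
invariance of `λ` on `{1, …, N}` under `n ↦ q n`. -/
theorem stmt_9 (p : ℕ) [Fact p.Prime] (q N : ℕ) (hq : 2 ≤ q) (hN : 1 ≤ N)
    (hqN : 2 * (q * N) ≤ p - 1)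
    (μ : ZMod p → ℝ) (hμnn : ∀ r, 0 ≤ μ r) (hμ0 : μ 0 = 0)
    (hμsum : ∑ r : ZMod p, μ r = 1)
    (δ δ' : ℝ) (hδ0 : 0 ≤ δ) (hδ1 : δ < 1)
    (hI : 1 - δ ≤ ∑ r ∈ Iset p N, μ r)
    (hinv : ∑ r ∈ Finset.univ.filter (fun r : ZMod p => r ≠ 0),
        |μ r - μ ((q : ZMod p) * r)| ≤ δ') :
    (∑ n ∈ (Finset.Icc 1 N).filter (fun n => q * n ≤ N),
        |lamOf p N μ n - lamOf p N μ (q * n)|)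
      + (∑ n ∈ (Finset.Icc 1 N).filter (fun n => N < q * n), lamOf p N μ n)
      ≤ (δ + 2 * δ') / (1 - δ) := by
  classical
  have hp : 2 ≤ p := (Fact.out : p.Prime).two_le
  set M := ∑ r ∈ Iset p N, μ r with hM
  have hMpos : 0 < M := by linarith
  have hq0 : (0 : ℕ) < q := by omega
  have hle : ∀ n ∈ Finset.Icc 1 N, 1 ≤ n ∧ 2 * n ≤ p - 1 := by
    intro n hn
    rw [Finset.mem_Icc] at hn
    refine ⟨hn.1, ?_⟩
    nlinarith
  have hne : ∀ n : ℕ, 1 ≤ n ∧ 2 * n ≤ p - 1 → (n : ZMod p) ≠ 0 := by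
    intro n hn h0
    rw [ZMod.natCast_eq_zero_iff] at h0
    have := Nat.le_of_dvd (by omega) h0
    omega
  let D : ZMod p → ℝ := fun r => |μ r - μ ((q : ZMod p) * r)|
  have hD : ∑ n ∈ Finset.Icc 1 N, (D (n : ZMod p) + D (-(n : ZMod p))) ≤ δ' := by
    refine le_trans (fold_sum_le p D (fun r => abs_nonneg _) _ hle _ ?_) hinv
    intro a ha
    have := hne a (hle a ha)
    simp [this]
  have hδ' : 0 ≤ δ' := le_trans (Finset.sum_nonneg fun r _ => abs_nonneg _) hinv
  let f : ℕ → ℝ := fun n => μ (n : ZMod p) + μ (-(n : ZMod p))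
  have hlam : ∀ n, lamOf p N μ n = f n / M := fun n => rfl
  have hdiff : ∀ n : ℕ, |f n - f (q * n)| ≤ D (n : ZMod p) + D (-(n : ZMod p)) := by
    intro n
    have e : f n - f (q * n) = (μ (n : ZMod p) - μ ((q : ZMod p) * n))
        + (μ (-(n : ZMod p)) - μ ((q : ZMod p) * -(n : ZMod p))) := by
      simp only [f]
      push_cast
      rw [mul_neg]
      ring
    rw [e]
    exact abs_add_le _ _
  have hout : ∑ n ∈ (Finset.Icc 1 N).filter (fun n => N < q * n), f (q * n) ≤ δ := by
    have hinj : Set.InjOn (fun n : ℕ => q * n)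
        (((Finset.Icc 1 N).filter (fun n => N < q * n) : Finset ℕ) : Set ℕ) :=
      fun a _ b _ h => Nat.eq_of_mul_eq_mul_left hq0 h
    rw [← Finset.sum_image (f := f) hinj]
    have hc : ∑ r ∈ (Iset p N)ᶜ, μ r ≤ δ := by
      have := Finset.sum_add_sum_compl (Iset p N) μ
      rw [hμsum] at this
      linarith
    refine le_trans (fold_sum_le p μ hμnn _ ?_ _ ?_) hc
    · intro a ha
      simp only [Finset.mem_image, Finset.mem_filter, Finset.mem_Icc] at ha
      obtain ⟨n, ⟨⟨h1, h2⟩, h3⟩, rfl⟩ := ha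
      have : q * n ≤ q * N := Nat.mul_le_mul_left q h2
      omega
    · intro a ha
      simp only [Finset.mem_image, Finset.mem_filter, Finset.mem_Icc] at ha
      obtain ⟨n, ⟨⟨h1, h2⟩, h3⟩, h4⟩ := ha
      have : q * n ≤ q * N := Nat.mul_le_mul_left q h2
      have hv : (a : ZMod p).valMinAbs = (a : ℤ) :=
        ZMod.valMinAbs_natCast_of_le_half (by omega)
      constructor
      · simp only [Iset, Finset.mem_compl, Finset.mem_filter, hv, Int.natAbs_natCast]
        omega
      · simp only [Iset, Finset.mem_compl, Finset.mem_filter, ZMod.natAbs_valMinAbs_neg, hv,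
          Int.natAbs_natCast]
        omega
  have key : (∑ n ∈ (Finset.Icc 1 N).filter (fun n => q * n ≤ N), |f n - f (q * n)|)
      + (∑ n ∈ (Finset.Icc 1 N).filter (fun n => N < q * n), f n) ≤ δ + δ' := by
    have h1 : ∑ n ∈ (Finset.Icc 1 N).filter (fun n => N < q * n), f n
        ≤ ∑ n ∈ (Finset.Icc 1 N).filter (fun n => N < q * n), |f n - f (q * n)|
          + ∑ n ∈ (Finset.Icc 1 N).filter (fun n => N < q * n), f (q * n) := by
      rw [← Finset.sum_add_distrib]
      apply Finset.sum_le_sum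
      intro n _
      linarith [le_abs_self (f n - f (q * n))]
    have h2 := Finset.sum_filter_add_sum_filter_not (Finset.Icc 1 N) (fun n => q * n ≤ N)
      (fun n => |f n - f (q * n)|)
    simp only [not_le] at h2
    have h3 : ∑ n ∈ Finset.Icc 1 N, |f n - f (q * n)| ≤ δ' :=
      le_trans (Finset.sum_le_sum fun n _ => hdiff n) hD
    linarith
  have e : (∑ n ∈ (Finset.Icc 1 N).filter (fun n => q * n ≤ N),
        |lamOf p N μ n - lamOf p N μ (q * n)|)
      + (∑ n ∈ (Finset.Icc 1 N).filter (fun n => N < q * n), lamOf p N μ n)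
      = ((∑ n ∈ (Finset.Icc 1 N).filter (fun n => q * n ≤ N), |f n - f (q * n)|)
      + (∑ n ∈ (Finset.Icc 1 N).filter (fun n => N < q * n), f n)) / M := by
    rw [add_div, Finset.sum_div, Finset.sum_div]
    simp only [hlam, ← sub_div, abs_div, abs_of_pos hMpos]
  rw [e]
  apply div_le_div₀ (by linarith) (by linarith) (by linarith) hI
end

section
/- Let N ≥ 1 and q ≥ 2 be integers, and let λ : {1, …, N} → ℝ≥0 satisfy ∑_{n=1}^{N} λ(n) = 1. Define (T_q λ)(n) := λ(q·n) if q·n ≤ N and (T_q λ)(n) := 0 otherwise. Suppose ∑_{n=1}^{N} |λ(n) − (T_q λ)(n)| ≤ η with 0 < η ≤ 1/8. Then ∑_{n=1}^{N} λ(n)·v_q(n) ≥ 1/(8η). -/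
lemma S_step (N q : ℕ) (hq : 2 ≤ q)
    (lam : ℕ → ℝ) (hnn : ∀ n ∈ Finset.Icc 1 N, 0 ≤ lam n) (η : ℝ)
    (hT : ∑ n ∈ Finset.Icc 1 N,
        |lam n - (if q * n ≤ N then lam (q * n) else 0)| ≤ η) (k : ℕ) :
    (∑ n ∈ Finset.Icc 1 N, if q ^ k ∣ n then lam n else 0) - η ≤
      ∑ n ∈ Finset.Icc 1 N, if q ^ (k + 1) ∣ n then lam n else 0 := by
  have h1 : ∑ n ∈ (Finset.Icc 1 N).filter (fun n => q ^ k ∣ n ∧ q * n ≤ N), lam (q * n) ≤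
      ∑ n ∈ Finset.Icc 1 N, if q ^ (k + 1) ∣ n then lam n else 0 := by
    rw [← Finset.sum_filter]
    rw [← Finset.sum_image (f := lam) (g := fun n => q * n)
      (fun a _ b _ h => Nat.eq_of_mul_eq_mul_left (by omega) h)]
    apply Finset.sum_le_sum_of_subset_of_nonneg
    · intro x hx
      simp only [Finset.mem_image, Finset.mem_filter, Finset.mem_Icc] at hx ⊢
      obtain ⟨a, ⟨⟨h1, h2⟩, h3, h4⟩, rfl⟩ := hx
      refine ⟨⟨Nat.mul_pos (by omega) h1, h4⟩, ?_⟩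
      rw [pow_succ, mul_comm]
      exact mul_dvd_mul_left q h3
    · intro i hi _
      exact hnn i (Finset.mem_filter.1 hi).1
  have h2 : (∑ n ∈ Finset.Icc 1 N, if q ^ k ∣ n then lam n else 0) -
      ∑ n ∈ (Finset.Icc 1 N).filter (fun n => q ^ k ∣ n ∧ q * n ≤ N), lam (q * n) ≤
      ∑ n ∈ Finset.Icc 1 N, |lam n - (if q * n ≤ N then lam (q * n) else 0)| := by
    rw [Finset.sum_filter, ← Finset.sum_sub_distrib]
    apply Finset.sum_le_sum
    intro n _
    by_cases h : q ^ k ∣ n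
    · simp only [h, true_and, if_true]
      exact le_abs_self _
    · simp [h]
  linarith

lemma S_bound (N q : ℕ) (hq : 2 ≤ q)
    (lam : ℕ → ℝ) (hnn : ∀ n ∈ Finset.Icc 1 N, 0 ≤ lam n)
    (hsum : ∑ n ∈ Finset.Icc 1 N, lam n = 1) (η : ℝ)
    (hT : ∑ n ∈ Finset.Icc 1 N,
        |lam n - (if q * n ≤ N then lam (q * n) else 0)| ≤ η) (k : ℕ) :
    1 - k * η ≤ ∑ n ∈ Finset.Icc 1 N, if q ^ k ∣ n then lam n else 0 := by
  induction k with
  | zero => simp [hsum]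
  | succ k ih =>
    have := S_step N q hq lam hnn η hT k
    push_cast
    linarith

lemma val_bound (q n K : ℕ) (hq : 2 ≤ q) (hn : 1 ≤ n) :
    ((Finset.Icc 1 K).filter (fun k => q ^ k ∣ n)).card ≤ Nat.maxPowDiv q n := by
  have : (Finset.Icc 1 K).filter (fun k => q ^ k ∣ n) ⊆ Finset.Icc 1 (Nat.maxPowDiv q n) := by
    intro k hk
    simp only [Finset.mem_filter, Finset.mem_Icc] at hk ⊢
    exact ⟨hk.1.1, (Nat.pow_dvd_iff_le_padicValNat (by omega) (by omega)).1 hk.2⟩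
  simpa using Finset.card_le_card this

/-- If a probability measure `λ` on `{1, …, N}` is almost invariant under `n ↦ q n`
(in the sense `‖λ − T_q λ‖₁ ≤ η ≤ 1/8`), then the expected `q`-adic valuation is at
least `1/(8η)`. Here `Nat.maxPowDiv q n` is the `q`-adic valuation `v_q(n)`. -/
theorem stmt_10 (N q : ℕ) (hN : 1 ≤ N) (hq : 2 ≤ q)
    (lam : ℕ → ℝ) (hnn : ∀ n ∈ Finset.Icc 1 N, 0 ≤ lam n)
    (hsum : ∑ n ∈ Finset.Icc 1 N, lam n = 1)
    (η : ℝ) (hη0 : 0 < η) (hη : η ≤ 1 / 8)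
    (hT : ∑ n ∈ Finset.Icc 1 N,
        |lam n - (if q * n ≤ N then lam (q * n) else 0)| ≤ η) :
    1 / (8 * η) ≤ ∑ n ∈ Finset.Icc 1 N, lam n * (Nat.maxPowDiv q n : ℝ) := by
  obtain ⟨K, hK⟩ : ∃ K, K = ⌊1 / (2 * η)⌋₊ := ⟨_, rfl⟩
  have hK1 : (K : ℝ) ≤ 1 / (2 * η) := by
    rw [hK]; exact Nat.floor_le (by positivity)
  have hK2 : 1 / (2 * η) < K + 1 := by
    rw [hK]; exact Nat.lt_floor_add_one _
  have hKη : (K : ℝ) * η ≤ 1 / 2 := by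
    rw [le_div_iff₀ (by positivity)] at hK1
    linarith
  have h1 : (K : ℝ) * (1 / 2) ≤ ∑ k ∈ Finset.Icc 1 K,
      ∑ n ∈ Finset.Icc 1 N, if q ^ k ∣ n then lam n else 0 := by
    have := Finset.card_nsmul_le_sum (Finset.Icc 1 K)
      (fun k => ∑ n ∈ Finset.Icc 1 N, if q ^ k ∣ n then lam n else 0) (1 / 2 : ℝ) (by
        intro k hk
        have hb := S_bound N q hq lam hnn hsum η hT k
        have hkK : (k : ℝ) ≤ K := by exact_mod_cast (Finset.mem_Icc.1 hk).2
        have := mul_le_mul_of_nonneg_right hkK hη0.le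
        linarith)
    simpa using this
  have h2 : ∑ k ∈ Finset.Icc 1 K, ∑ n ∈ Finset.Icc 1 N, (if q ^ k ∣ n then lam n else 0) ≤
      ∑ n ∈ Finset.Icc 1 N, lam n * (Nat.maxPowDiv q n : ℝ) := by
    rw [Finset.sum_comm]
    apply Finset.sum_le_sum
    intro n hn
    rw [← Finset.sum_filter, Finset.sum_const, nsmul_eq_mul, mul_comm]
    apply mul_le_mul_of_nonneg_left _ (hnn n hn)
    exact_mod_cast val_bound q n K hq (Finset.mem_Icc.1 hn).1
  have e1 : 1 / (2 * η) = 4 * (1 / (8 * η)) := by field_simp; norm_num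
  have e2 : 1 ≤ 1 / (8 * η) := by
    rw [le_div_iff₀ (by positivity)]; linarith
  linarith
end
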